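/- arXiv:1107.4058 — 5 statements merged into one kernel-verified Lean document; each statement's English description precedes it below -/
import Mathlib

section
/- Let p ≥ 0 be an integer, let d : {0,…,p} → ℝ satisfy d_k = 0 for every odd k, let S be an invertible real (p+1)×(p+1) matrix with S_{kl} = 0 whenever k+l is odd, let S̃ be a real (p+1)×(p+1) matrix with S̃_{kl} = 0 whenever k+l is even, and let S* be the (p+1)×(p+1) matrix with entries (S*)_{kl} = d_k d_l. Then for every ν ∈ {0,…,p}, e_νᵀ S^{-1} S̃ S^{-1} S* S^{-1} e_ν = 0. -/
namespace Matrix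

/-- The diagonal matrix with entries `(-1) ^ k`. -/
def altSign (n : ℕ) : Matrix (Fin n) (Fin n) ℝ :=
  diagonal fun k => (-1) ^ (k : ℕ)

lemma commute_altSign {n : ℕ} {A : Matrix (Fin n) (Fin n) ℝ}
    (hA : ∀ k l : Fin n, Odd ((k : ℕ) + (l : ℕ)) → A k l = 0) :
    Commute (altSign n) A := by
  ext k l
  rw [altSign, diagonal_mul, mul_diagonal]
  rcases Nat.even_or_odd (k : ℕ) with hk | hk <;> rcases Nat.even_or_odd (l : ℕ) with hl | hl
  · simp [hk.neg_one_pow, hl.neg_one_pow]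
  · simp [hA k l (hk.add_odd hl)]
  · simp [hA k l (hk.add_even hl)]
  · simp [hk.neg_one_pow, hl.neg_one_pow]

lemma altSign_mul_eq_neg {n : ℕ} {A : Matrix (Fin n) (Fin n) ℝ}
    (hA : ∀ k l : Fin n, Even ((k : ℕ) + (l : ℕ)) → A k l = 0) :
    altSign n * A = -(A * altSign n) := by
  ext k l
  rw [neg_apply, altSign, diagonal_mul, mul_diagonal]
  rcases Nat.even_or_odd (k : ℕ) with hk | hk <;> rcases Nat.even_or_odd (l : ℕ) with hl | hl
  · simp [hA k l (hk.add hl)]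
  · simp [hk.neg_one_pow, hl.neg_one_pow]
  · simp [hk.neg_one_pow, hl.neg_one_pow]
  · simp [hA k l (hk.add_odd hl)]

lemma diag_eq_zero_of_altSign_mul_eq_neg {n : ℕ} {A : Matrix (Fin n) (Fin n) ℝ}
    (hA : altSign n * A = -(A * altSign n)) (k : Fin n) : A k k = 0 := by
  have h := congrFun (congrFun hA k) k
  rw [neg_apply, altSign, diagonal_mul, mul_diagonal] at h
  have h₂ : (-1 : ℝ) ^ (k : ℕ) * A k k = 0 := by linarith
  exact (mul_eq_zero.mp h₂).resolve_left (pow_ne_zero _ (by norm_num))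

end Matrix

/-- first vanishing identity (var1) of the paper.
`d` has vanishing odd entries, `S` is invertible with checkerboard sparsity
(`S k l = 0` for `k+l` odd), `S̃` has the complementary sparsity
(`S̃ k l = 0` for `k+l` even), and `S*` has entries `d k * d l`.
Then `e_νᵀ S⁻¹ S̃ S⁻¹ S* S⁻¹ e_ν = 0` for every `ν`. -/
theorem stmt_1 (p : ℕ) (d : Fin (p + 1) → ℝ)
    (hd : ∀ k : Fin (p + 1), Odd (k : ℕ) → d k = 0)
    (S St Sast : Matrix (Fin (p + 1)) (Fin (p + 1)) ℝ)
    (hS : IsUnit S.det)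
    (hSsparse : ∀ k l : Fin (p + 1), Odd ((k : ℕ) + (l : ℕ)) → S k l = 0)
    (hStsparse : ∀ k l : Fin (p + 1), Even ((k : ℕ) + (l : ℕ)) → St k l = 0)
    (hSast : ∀ k l : Fin (p + 1), Sast k l = d k * d l)
    (ν : Fin (p + 1)) :
    (S⁻¹ * St * S⁻¹ * Sast * S⁻¹) ν ν = 0 := by
  have hInv : Commute (Matrix.altSign (p + 1)) S⁻¹ := by
    have hComm := (Matrix.commute_altSign hSsparse).eq
    calc Matrix.altSign (p + 1) * S⁻¹
        = S⁻¹ * (S * Matrix.altSign (p + 1)) * S⁻¹ := by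
          rw [Matrix.nonsing_inv_mul_cancel_left _ _ hS]
      _ = S⁻¹ * Matrix.altSign (p + 1) := by
          rw [← hComm, ← Matrix.mul_assoc, Matrix.mul_nonsing_inv_cancel_right _ _ hS]
  have hAst : Commute (Matrix.altSign (p + 1)) Sast := by
    refine Matrix.commute_altSign fun k l hkl => ?_
    rw [hSast]
    rcases Nat.even_or_odd (k : ℕ) with hk | hk
    · rw [hd l ((Nat.odd_add'.mp hkl).mpr hk), mul_zero]
    · rw [hd k hk, zero_mul]
  have hSt := Matrix.altSign_mul_eq_neg hStsparse
  apply Matrix.diag_eq_zero_of_altSign_mul_eq_neg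
  have hRight := (hInv.mul_right hAst).mul_right hInv
  calc Matrix.altSign (p + 1) * (S⁻¹ * St * S⁻¹ * Sast * S⁻¹)
      = Matrix.altSign (p + 1) * S⁻¹ * St * (S⁻¹ * Sast * S⁻¹) := by
        simp only [Matrix.mul_assoc]
    _ = S⁻¹ * (Matrix.altSign (p + 1) * St) * (S⁻¹ * Sast * S⁻¹) := by
        rw [hInv.eq, Matrix.mul_assoc S⁻¹]
    _ = -(S⁻¹ * St * (Matrix.altSign (p + 1) * (S⁻¹ * Sast * S⁻¹))) := by
        rw [hSt]
        simp only [Matrix.mul_neg, Matrix.neg_mul, Matrix.mul_assoc]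
    _ = -(S⁻¹ * St * S⁻¹ * Sast * S⁻¹ * Matrix.altSign (p + 1)) := by
        rw [hRight.eq]
        simp only [Matrix.mul_assoc]
end

section
/- Let ρ : [0,1]² → ℝ be continuous, symmetric (ρ(s,t) = ρ(t,s)) and positive semidefinite, such that on each of the closed triangles T⁻ = {(s,t) : 0 ≤ t ≤ s ≤ 1} and T⁺ = {(s,t) : 0 ≤ s ≤ t ≤ 1} the partial derivative of ρ in its second variable exists in the interior and extends continuously to the triangle. Then for every x ∈ (0,1), α(x) = ρ^{(0,1)}(x,x⁻) − ρ^{(0,1)}(x,x⁺) ≥ 0. -/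
open MeasureTheory Set

/-- Lemma 1 of the paper: let `ρ : [0,1]² → ℝ` be continuous,
symmetric, and positive semidefinite, and suppose that on each closed triangle
`T⁻ = {(s,t) : 0 ≤ t ≤ s ≤ 1}` and `T⁺ = {(s,t) : 0 ≤ s ≤ t ≤ 1}` the partial
derivative of `ρ` in its second variable exists in the interior and extends
continuously to the triangle (extensions `Dm` on `T⁻` and `Dp` on `T⁺`).
Then for every `x ∈ (0,1)`, `α(x) = ρ^{(0,1)}(x,x⁻) − ρ^{(0,1)}(x,x⁺) ≥ 0`. -/
theorem stmt_4 (ρ : ℝ → ℝ → ℝ)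
    (hρc : ContinuousOn (fun q : ℝ × ℝ => ρ q.1 q.2) (Icc 0 1 ×ˢ Icc 0 1))
    (hρsym : ∀ s t, s ∈ Icc (0:ℝ) 1 → t ∈ Icc (0:ℝ) 1 → ρ s t = ρ t s)
    (hpsd : ∀ (m : ℕ) (t : Fin m → ℝ), (∀ i, t i ∈ Icc (0:ℝ) 1) →
      ∀ c : Fin m → ℝ, 0 ≤ ∑ i, ∑ j, c i * c j * ρ (t i) (t j))
    (Dm Dp : ℝ → ℝ → ℝ)
    (hDmc : ContinuousOn (fun q : ℝ × ℝ => Dm q.1 q.2)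
      {q : ℝ × ℝ | 0 ≤ q.2 ∧ q.2 ≤ q.1 ∧ q.1 ≤ 1})
    (hDm : ∀ s t : ℝ, 0 < t → t < s → s < 1 → HasDerivAt (fun z => ρ s z) (Dm s t) t)
    (hDpc : ContinuousOn (fun q : ℝ × ℝ => Dp q.1 q.2)
      {q : ℝ × ℝ | 0 ≤ q.1 ∧ q.1 ≤ q.2 ∧ q.2 ≤ 1})
    (hDp : ∀ s t : ℝ, 0 < s → s < t → t < 1 → HasDerivAt (fun z => ρ s z) (Dp s t) t)
    (x : ℝ) (hx : x ∈ Ioo (0:ℝ) 1) :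
    0 ≤ Dm x x - Dp x x := by
  obtain ⟨hx0, hx1⟩ := hx
  by_contra! hneg
  obtain ⟨δ₁, hδ₁, hm⟩ := Metric.continuousOn_iff.1 hDmc (x, x) ⟨hx0.le, le_rfl, hx1.le⟩
    ((Dp x x - Dm x x) / 2) (by linarith)
  obtain ⟨δ₂, hδ₂, hp⟩ := Metric.continuousOn_iff.1 hDpc (x, x) ⟨hx0.le, le_rfl, hx1.le⟩
    ((Dp x x - Dm x x) / 2) (by linarith)
  obtain ⟨y, hxy, hy⟩ : ∃ y, x < y ∧ y < min 1 (min (x + δ₁) (x + δ₂)) :=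
    exists_between (by simp [hx1, hδ₁, hδ₂])
  simp only [lt_min_iff] at hy
  obtain ⟨hy1, hyδ₁, hyδ₂⟩ := hy
  have hxI : x ∈ Icc (0 : ℝ) 1 := ⟨hx0.le, hx1.le⟩
  have hyI : y ∈ Icc (0 : ℝ) 1 := ⟨by linarith, hy1.le⟩
  have hcont : ∀ s ∈ Icc (0 : ℝ) 1, ContinuousOn (fun z => ρ s z) (Icc x y) := fun s hs =>
    hρc.comp (f := fun z : ℝ => (s, z)) (by fun_prop)
      fun z hz => ⟨hs, hx0.le.trans hz.1, hz.2.trans hy1.le⟩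
  obtain ⟨ξ, ⟨hξ, hξ'⟩, hξs⟩ := exists_hasDerivAt_eq_slope (fun z => ρ y z) (Dm y) hxy
    (hcont y hyI) fun z hz => hDm y z (hx0.trans hz.1) hz.2 hy1
  obtain ⟨η, ⟨hη, hη'⟩, hηs⟩ := exists_hasDerivAt_eq_slope (fun z => ρ x z) (Dp x) hxy
    (hcont x hxI) fun z hz => hDp x z hx0 hz.1 (hz.2.trans hy1)
  -- The variance of the increment `X y - X x`, divided by `y - x`.
  have hinc : 0 ≤ Dm y ξ - Dp x η := by
    have h := hpsd 2 ![x, y] (by simp [Fin.forall_fin_two, hxI.1, hxI.2, hyI.1, hyI.2]) ![-1, 1]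
    simp only [Fin.sum_univ_two, Matrix.cons_val_zero, Matrix.cons_val_one] at h
    rw [hξs, hηs, ← sub_div]
    exact div_nonneg (by linarith) (by linarith)
  have h₁ := hm (y, ξ) ⟨by linarith, hξ'.le, hy1.le⟩ (by
    rw [Prod.dist_eq, max_lt_iff, Real.dist_eq, Real.dist_eq, abs_lt, abs_lt]
    refine ⟨⟨?_, ?_⟩, ?_, ?_⟩ <;> dsimp only <;> linarith)
  have h₂ := hp (x, η) ⟨hx0.le, hη.le, by linarith⟩ (by
    rw [Prod.dist_eq, max_lt_iff, Real.dist_eq, Real.dist_eq, abs_lt, abs_lt]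
    refine ⟨⟨?_, ?_⟩, ?_, ?_⟩ <;> dsimp only <;> linarith)
  rw [Real.dist_eq, abs_lt] at h₁ h₂
  linarith [h₁.2, h₂.1]
end

section
/- Let ρ : [0,1]² → ℝ be continuous and symmetric (ρ(s,t) = ρ(t,s)), such that on each of the closed triangles T⁻ = {(s,t) : 0 ≤ t ≤ s ≤ 1} and T⁺ = {(s,t) : 0 ≤ s ≤ t ≤ 1} the partial derivative of ρ in its second variable exists in the interior and extends continuously to the triangle. Fix x ∈ (0,1) and write a⁻ = ρ^{(0,1)}(x,x⁻), a⁺ = ρ^{(0,1)}(x,x⁺). Then sup_{u,v ∈ [-1,1]} | ρ(x+hu, x+hv) − ρ(x,x) − h · min(u,v) · a⁻ − h · max(u,v) · a⁺ | = o(h) as h → 0⁺, i.e. this supremum divided by h tends to 0 as h tends to 0 from the right. -/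
open MeasureTheory Set Filter Topology

/-- Mean value estimate: if the derivative stays within `ε` of `c`, the increment stays within
`ε * (b - a)` of `(b - a) * c`. -/
lemma abs_sub_sub_mul_le_of_abs_deriv_sub_le {f f' : ℝ → ℝ} {a b c ε : ℝ} (hab : a ≤ b)
    (hf : ContinuousOn f (Icc a b)) (hf' : ∀ t ∈ Ioo a b, HasDerivAt f (f' t) t)
    (hε : ∀ t ∈ Ioo a b, |f' t - c| ≤ ε) :
    |f b - f a - (b - a) * c| ≤ ε * (b - a) := by
  rcases hab.eq_or_lt with rfl | hlt
  · simp
  obtain ⟨t, ht, h⟩ := exists_hasDerivAt_eq_slope f f' hlt hf hf'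
  have hpos : 0 < b - a := sub_pos.2 hlt
  have heq : f b - f a - (b - a) * c = (f' t - c) * (b - a) := by
    rw [h]; field_simp
  rw [heq, abs_mul, abs_of_pos hpos]
  exact mul_le_mul_of_nonneg_right (hε t ht) hpos.le

/-- A kernel on a set `S` of reals whose increments in the second variable are `ε`-close to linear,
with slope `a` below the diagonal and `b` above it, expands to first order around any diagonal point
of `S`. -/
lemma abs_sub_diag_le_of_le {ρ : ℝ → ℝ → ℝ} {S : Set ℝ} {a b ε x h : ℝ} (hε : 0 ≤ ε)
    (hsym : ∀ s ∈ S, ∀ t ∈ S, ρ s t = ρ t s)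
    (hbelow : ∀ s ∈ S, ∀ t ∈ S, t ≤ s → |ρ s s - ρ s t - (s - t) * a| ≤ ε * (s - t))
    (habove : ∀ s ∈ S, ∀ t ∈ S, s ≤ t → |ρ s t - ρ s s - (t - s) * b| ≤ ε * (t - s))
    (hx : x ∈ S) {s t : ℝ} (hs : s ∈ S) (ht : t ∈ S) (hst : s ≤ t)
    (hsx : |s - x| ≤ h) (htx : |t - x| ≤ h) :
    |ρ s t - ρ x x - (s - x) * a - (t - x) * b| ≤ 4 * ε * h := by
  have hdiag : ∀ p ∈ S, ∀ q ∈ S, p ≤ q →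
      |ρ q q - ρ p p - (q - p) * (a + b)| ≤ 2 * ε * (q - p) := by
    intro p hp q hq hpq
    have h₁ := abs_le.1 (hbelow q hq p hp hpq)
    have h₂ := abs_le.1 (habove p hp q hq hpq)
    rw [hsym q hq p hp] at h₁
    rw [abs_le]
    constructor <;> linarith [h₁.1, h₁.2, h₂.1, h₂.2]
  have h₁ := abs_le.1 (habove s hs t ht hst)
  rw [abs_le] at hsx htx
  have h₂ : ε * (t - s) ≤ ε * (2 * h) := mul_le_mul_of_nonneg_left (by linarith) hε
  rw [abs_le]
  rcases le_total s x with hle | hle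
  · have h₃ := abs_le.1 (hdiag s hs x hx hle)
    have h₄ : ε * (x - s) ≤ ε * h := mul_le_mul_of_nonneg_left (by linarith) hε
    constructor <;> linarith [h₁.1, h₁.2, h₃.1, h₃.2]
  · have h₃ := abs_le.1 (hdiag x hx s hs hle)
    have h₄ : ε * (s - x) ≤ ε * h := mul_le_mul_of_nonneg_left (by linarith) hε
    constructor <;> linarith [h₁.1, h₁.2, h₃.1, h₃.2]

/-- Symmetric form of `abs_sub_diag_le_of_le`, without an ordering of the two arguments. -/
lemma abs_sub_diag_le {ρ : ℝ → ℝ → ℝ} {S : Set ℝ} {a b ε x h : ℝ} (hε : 0 ≤ ε)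
    (hsym : ∀ s ∈ S, ∀ t ∈ S, ρ s t = ρ t s)
    (hbelow : ∀ s ∈ S, ∀ t ∈ S, t ≤ s → |ρ s s - ρ s t - (s - t) * a| ≤ ε * (s - t))
    (habove : ∀ s ∈ S, ∀ t ∈ S, s ≤ t → |ρ s t - ρ s s - (t - s) * b| ≤ ε * (t - s))
    (hx : x ∈ S) {s t : ℝ} (hs : s ∈ S) (ht : t ∈ S) (hsx : |s - x| ≤ h) (htx : |t - x| ≤ h) :
    |ρ s t - ρ x x - (min s t - x) * a - (max s t - x) * b| ≤ 4 * ε * h := by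
  rcases le_total s t with hst | hst
  · rw [min_eq_left hst, max_eq_right hst]
    exact abs_sub_diag_le_of_le hε hsym hbelow habove hx hs ht hst hsx htx
  · rw [min_eq_right hst, max_eq_left hst, hsym s hs t ht]
    exact abs_sub_diag_le_of_le hε hsym hbelow habove hx ht hs hst htx hsx

/-- uniform one-sided Taylor expansion, eq. (taylor expansion 1):
with `ρ` continuous and symmetric on `[0,1]²`, whose partial derivative in the
second variable exists in the interior of each closed triangle `T⁻`, `T⁺` and
extends continuously (extensions `Dm`, `Dp`), for `x ∈ (0,1)`,
`sup_{u,v ∈ [-1,1]} |ρ(x+hu, x+hv) − ρ(x,x) − h min(u,v) a⁻ − h max(u,v) a⁺| = o(h)`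
as `h → 0⁺`, where `a⁻ = Dm x x` and `a⁺ = Dp x x`. -/
theorem stmt_5 (ρ : ℝ → ℝ → ℝ)
    (hρc : ContinuousOn (fun q : ℝ × ℝ => ρ q.1 q.2) (Icc 0 1 ×ˢ Icc 0 1))
    (hρsym : ∀ s t, s ∈ Icc (0:ℝ) 1 → t ∈ Icc (0:ℝ) 1 → ρ s t = ρ t s)
    (Dm Dp : ℝ → ℝ → ℝ)
    (hDmc : ContinuousOn (fun q : ℝ × ℝ => Dm q.1 q.2)
      {q : ℝ × ℝ | 0 ≤ q.2 ∧ q.2 ≤ q.1 ∧ q.1 ≤ 1})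
    (hDm : ∀ s t : ℝ, 0 < t → t < s → s < 1 → HasDerivAt (fun z => ρ s z) (Dm s t) t)
    (hDpc : ContinuousOn (fun q : ℝ × ℝ => Dp q.1 q.2)
      {q : ℝ × ℝ | 0 ≤ q.1 ∧ q.1 ≤ q.2 ∧ q.2 ≤ 1})
    (hDp : ∀ s t : ℝ, 0 < s → s < t → t < 1 → HasDerivAt (fun z => ρ s z) (Dp s t) t)
    (x : ℝ) (hx : x ∈ Ioo (0:ℝ) 1) :
    Tendsto (fun h : ℝ =>
        (⨆ u : Icc (-1:ℝ) 1, ⨆ v : Icc (-1:ℝ) 1,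
          |ρ (x + h * u) (x + h * v) - ρ x x
            - h * min (u : ℝ) (v : ℝ) * Dm x x
            - h * max (u : ℝ) (v : ℝ) * Dp x x|) / h)
      (𝓝[>] (0:ℝ)) (𝓝 0) := by
  rw [Metric.tendsto_nhdsWithin_nhds]
  intro η hη
  set ε := η / 8 with hεdef
  have hε : 0 < ε := by positivity
  obtain ⟨hx0, hx1⟩ := hx
  obtain ⟨δ₁, hδ₁, hm⟩ := Metric.continuousOn_iff.1 hDmc (x, x) ⟨hx0.le, le_rfl, hx1.le⟩ ε hε
  obtain ⟨δ₂, hδ₂, hp⟩ := Metric.continuousOn_iff.1 hDpc (x, x) ⟨hx0.le, le_rfl, hx1.le⟩ ε hε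
  set δ := min (min δ₁ δ₂) (min x (1 - x)) with hδdef
  have hδ : 0 < δ := lt_min (lt_min hδ₁ hδ₂) (lt_min hx0 (by linarith))
  have hδle₁ : δ ≤ δ₁ := (min_le_left _ _).trans (min_le_left _ _)
  have hδle₂ : δ ≤ δ₂ := (min_le_left _ _).trans (min_le_right _ _)
  have hδx : δ ≤ x := (min_le_right _ _).trans (min_le_left _ _)
  have hδx' : δ ≤ 1 - x := (min_le_right _ _).trans (min_le_right _ _)
  have hunit : ∀ s ∈ Ioo (x - δ) (x + δ), 0 < s ∧ s < 1 := fun s hs =>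
    ⟨by linarith [hs.1], by linarith [hs.2]⟩
  have hdist : ∀ s ∈ Ioo (x - δ) (x + δ), ∀ t ∈ Ioo (x - δ) (x + δ),
      dist (s, t) (x, x) < δ := by
    intro s hs t ht
    rw [Prod.dist_eq, max_lt_iff, Real.dist_eq, Real.dist_eq, abs_lt, abs_lt]
    exact ⟨⟨by linarith [hs.1], by linarith [hs.2]⟩, ⟨by linarith [ht.1], by linarith [ht.2]⟩⟩
  have hcont : ∀ s ∈ Ioo (x - δ) (x + δ), ContinuousOn (fun z => ρ s z) (Icc 0 1) := by
    intro s hs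
    exact hρc.comp (f := fun z : ℝ => (s, z)) (by fun_prop)
      fun z hz => ⟨⟨(hunit s hs).1.le, (hunit s hs).2.le⟩, hz⟩
  have hsym : ∀ s ∈ Ioo (x - δ) (x + δ), ∀ t ∈ Ioo (x - δ) (x + δ), ρ s t = ρ t s :=
    fun s hs t ht => hρsym s t ⟨(hunit s hs).1.le, (hunit s hs).2.le⟩
      ⟨(hunit t ht).1.le, (hunit t ht).2.le⟩
  have hbelow : ∀ s ∈ Ioo (x - δ) (x + δ), ∀ t ∈ Ioo (x - δ) (x + δ), t ≤ s →
      |ρ s s - ρ s t - (s - t) * Dm x x| ≤ ε * (s - t) := by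
    intro s hs t ht hts
    have hs' := hunit s hs
    have ht' := hunit t ht
    refine abs_sub_sub_mul_le_of_abs_deriv_sub_le (f := fun z => ρ s z) (f' := Dm s) hts
      ((hcont s hs).mono (Icc_subset_Icc ht'.1.le hs'.2.le))
      (fun z hz => hDm s z (ht'.1.trans hz.1) hz.2 hs'.2) fun z hz => ?_
    have hd := hm (s, z) ⟨(ht'.1.trans hz.1).le, hz.2.le, hs'.2.le⟩
      ((hdist s hs z ⟨ht.1.trans hz.1, hz.2.trans hs.2⟩).trans_le hδle₁)
    exact hd.le
  have habove : ∀ s ∈ Ioo (x - δ) (x + δ), ∀ t ∈ Ioo (x - δ) (x + δ), s ≤ t →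
      |ρ s t - ρ s s - (t - s) * Dp x x| ≤ ε * (t - s) := by
    intro s hs t ht hst
    have hs' := hunit s hs
    have ht' := hunit t ht
    refine abs_sub_sub_mul_le_of_abs_deriv_sub_le (f := fun z => ρ s z) (f' := Dp s) hst
      ((hcont s hs).mono (Icc_subset_Icc hs'.1.le ht'.2.le))
      (fun z hz => hDp s z hs'.1 hz.1 (hz.2.trans ht'.2)) fun z hz => ?_
    have hd := hp (s, z) ⟨hs'.1.le, hz.1.le, (hz.2.trans ht'.2).le⟩
      ((hdist s hs z ⟨hs.1.trans hz.1, hz.2.trans ht.2⟩).trans_le hδle₂)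
    exact hd.le
  refine ⟨δ, hδ, fun h (hh : 0 < h) hhδ => ?_⟩
  rw [Real.dist_eq, sub_zero, abs_of_pos hh] at hhδ
  have hmul : ∀ u : Icc (-1 : ℝ) 1, |x + h * u - x| ≤ h := by
    rintro ⟨u, hu⟩
    rw [add_sub_cancel_left, abs_mul, abs_of_pos hh]
    exact mul_le_of_le_one_right hh.le (abs_le.2 hu)
  have hmem : ∀ u : Icc (-1 : ℝ) 1, x + h * u ∈ Ioo (x - δ) (x + δ) := by
    intro u
    have := abs_le.1 (hmul u)
    exact ⟨by linarith [this.1], by linarith [this.2]⟩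
  have hbound : (⨆ u : Icc (-1:ℝ) 1, ⨆ v : Icc (-1:ℝ) 1,
      |ρ (x + h * u) (x + h * v) - ρ x x - h * min (u : ℝ) (v : ℝ) * Dm x x
        - h * max (u : ℝ) (v : ℝ) * Dp x x|) ≤ 4 * ε * h := by
    refine Real.iSup_le (fun u => Real.iSup_le (fun v => ?_) (by positivity)) (by positivity)
    have key := abs_sub_diag_le hε.le hsym hbelow habove ⟨by linarith, by linarith⟩
      (hmem u) (hmem v) (hmul u) (hmul v)
    rwa [min_add_add_left, max_add_add_left, add_sub_cancel_left, add_sub_cancel_left,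
      ← mul_min_of_nonneg _ _ hh.le, ← mul_max_of_nonneg _ _ hh.le] at key
  rw [Real.dist_eq, sub_zero, abs_of_nonneg
    (div_nonneg (Real.iSup_nonneg fun u => Real.iSup_nonneg fun v => abs_nonneg _) hh.le),
    div_lt_iff₀ hh]
  exact hbound.trans_lt (mul_lt_mul_of_pos_right (by linarith) hh)
end

section
/- Let ρ : [0,1]² → ℝ be continuous and symmetric (ρ(s,t) = ρ(t,s)), such that on each of the closed triangles T⁻ = {(s,t) : 0 ≤ t ≤ s ≤ 1} and T⁺ = {(s,t) : 0 ≤ s ≤ t ≤ 1} the partial derivative of ρ in its second variable exists in the interior and extends continuously to the triangle. Fix x ∈ (0,1), write a⁻ = ρ^{(0,1)}(x,x⁻), a⁺ = ρ^{(0,1)}(x,x⁺), and let g : [-1,1] → ℝ be continuous. Then lim_{h→0⁺} h^{-1} [ ∬_{[-1,1]²} ρ(x+hu, x+hv) g(u) g(v) du dv − ρ(x,x) (∫_{-1}^{1} g(u) du)² ] = (a⁺ + a⁻) (∫_{-1}^{1} g(u) du)(∫_{-1}^{1} v g(v) dv) + ((a⁺ − a⁻)/2) ∬_{[-1,1]²}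 |u−v| g(u) g(v) du dv. -/
open MeasureTheory Set Filter Topology

/-- First-order expansion off the diagonal point `(s, s)`, uniformly for `s` near `x`, of a function
whose second partial derivative extends continuously to both closed triangles. -/
theorem exists_forall_abs_sub_diag_le {ρ Dm Dp : ℝ → ℝ → ℝ}
    (hρc : ContinuousOn (fun q : ℝ × ℝ => ρ q.1 q.2) (Icc 0 1 ×ˢ Icc 0 1))
    (hDmc : ContinuousOn (fun q : ℝ × ℝ => Dm q.1 q.2)
      {q : ℝ × ℝ | 0 ≤ q.2 ∧ q.2 ≤ q.1 ∧ q.1 ≤ 1})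
    (hDm : ∀ s t : ℝ, 0 < t → t < s → s < 1 → HasDerivAt (fun z => ρ s z) (Dm s t) t)
    (hDpc : ContinuousOn (fun q : ℝ × ℝ => Dp q.1 q.2)
      {q : ℝ × ℝ | 0 ≤ q.1 ∧ q.1 ≤ q.2 ∧ q.2 ≤ 1})
    (hDp : ∀ s t : ℝ, 0 < s → s < t → t < 1 → HasDerivAt (fun z => ρ s z) (Dp s t) t)
    {x : ℝ} (hx : x ∈ Ioo (0 : ℝ) 1) {ε : ℝ} (hε : 0 < ε) :
    ∃ δ > 0, δ < x ∧ δ < 1 - x ∧ ∀ s t : ℝ, |s - x| < δ → |t - x| < δ →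
      |ρ s t - ρ s s - ((Dp x x + Dm x x) / 2 * (t - s) + (Dp x x - Dm x x) / 2 * |t - s|)|
        ≤ ε * |t - s| := by
  obtain ⟨hx0, hx1⟩ := hx
  obtain ⟨δm, hδm, hm⟩ := Metric.continuousWithinAt_iff.1
    (hDmc (x, x) ⟨hx0.le, le_rfl, hx1.le⟩) ε hε
  obtain ⟨δp, hδp, hp⟩ := Metric.continuousWithinAt_iff.1
    (hDpc (x, x) ⟨hx0.le, le_rfl, hx1.le⟩) ε hε
  obtain ⟨δ, hδ, hδlt⟩ := exists_between
    (show (0 : ℝ) < min (min δm δp) (min x (1 - x)) by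
      simp only [lt_min_iff]; exact ⟨⟨hδm, hδp⟩, hx0, by linarith⟩)
  simp only [lt_min_iff] at hδlt
  obtain ⟨⟨hlm, hlp⟩, hlx, hlx'⟩ := hδlt
  refine ⟨δ, hδ, hlx, hlx', fun s t hs ht => ?_⟩
  rw [abs_lt] at hs ht
  have hcont : ContinuousOn (fun z => ρ s z) (Icc 0 1) :=
    hρc.comp (by fun_prop : Continuous fun z : ℝ => (s, z)).continuousOn
      fun z hz => ⟨⟨by linarith, by linarith⟩, hz⟩
  rcases lt_trichotomy s t with hst | rfl | hst
  · obtain ⟨c, hc, hslope⟩ := exists_hasDerivAt_eq_slope (fun z => ρ s z) (Dp s) hst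
      (hcont.mono (Icc_subset_Icc (by linarith) (by linarith)))
      fun z hz => hDp s z (by linarith) hz.1 (by linarith [hz.2])
    have hd := hp (x := (s, c)) ⟨by simp; linarith, hc.1.le, by have := hc.2; simp; linarith⟩ (by
      rw [Prod.dist_eq, max_lt_iff, Real.dist_eq, Real.dist_eq, abs_lt, abs_lt]
      have := hc.1
      have := hc.2
      simp only
      refine ⟨⟨?_, ?_⟩, ?_, ?_⟩ <;> linarith)
    rw [Real.dist_eq] at hd
    rw [eq_div_iff (by linarith)] at hslope
    rw [abs_of_pos (sub_pos.2 hst), ← hslope,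
      show ∀ P M D d : ℝ, D * d - ((P + M) / 2 * d + (P - M) / 2 * d) = (D - P) * d by
        intros; ring, abs_mul, abs_of_pos (sub_pos.2 hst)]
    exact mul_le_mul_of_nonneg_right hd.le (by linarith)
  · simp
  · obtain ⟨c, hc, hslope⟩ := exists_hasDerivAt_eq_slope (fun z => ρ s z) (Dm s) hst
      (hcont.mono (Icc_subset_Icc (by linarith) (by linarith)))
      fun z hz => hDm s z (by linarith [hz.1]) hz.2 (by linarith)
    have hd := hm (x := (s, c)) ⟨by have := hc.1; simp; linarith, hc.2.le, by simp; linarith⟩ (by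
      rw [Prod.dist_eq, max_lt_iff, Real.dist_eq, Real.dist_eq, abs_lt, abs_lt]
      have := hc.1
      have := hc.2
      simp only
      refine ⟨⟨?_, ?_⟩, ?_, ?_⟩ <;> linarith)
    rw [Real.dist_eq] at hd
    rw [eq_div_iff (by linarith)] at hslope
    rw [show ρ s t - ρ s s = Dm s c * (t - s) by linarith, abs_of_neg (sub_neg.2 hst),
      show ∀ P M D d : ℝ, D * d - ((P + M) / 2 * d + (P - M) / 2 * -d) = (D - M) * d by
        intros; ring, abs_mul, abs_of_neg (sub_neg.2 hst)]
    exact mul_le_mul_of_nonneg_right hd.le (by linarith)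

/-- Integrals over a square of a product kernel minus its first-order expansion, with all
functions continuous. -/
theorem integral_integral_expansion_eq {R : ℝ → ℝ → ℝ} {G : ℝ → ℝ}
    (hR : Continuous fun q : ℝ × ℝ => R q.1 q.2) (hG : Continuous G) (r p m h : ℝ) :
    (∫ u in (-1 : ℝ)..1, ∫ v in (-1 : ℝ)..1,
        (R u v - r - h * (p * (u + v) + m * |u - v|)) * G u * G v)
      = (∫ u in (-1 : ℝ)..1, ∫ v in (-1 : ℝ)..1, R u v * G u * G v)
        - r * (∫ u in (-1 : ℝ)..1, G u) ^ 2
        - h * (2 * p * (∫ u in (-1 : ℝ)..1, G u) * (∫ v in (-1 : ℝ)..1, v * G v)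
          + m * ∫ u in (-1 : ℝ)..1, ∫ v in (-1 : ℝ)..1, |u - v| * G u * G v) := by
  have hR₁ (u : ℝ) : Continuous (R u) := hR.comp (by fun_prop : Continuous fun v : ℝ => (u, v))
  have hRi : Continuous fun u => ∫ v in (-1 : ℝ)..1, R u v * G u * G v :=
    intervalIntegral.continuous_parametric_intervalIntegral_of_continuous' (by
      simp only [Function.uncurry_def]; fun_prop) _ _
  have hAi : Continuous fun u => ∫ v in (-1 : ℝ)..1, |u - v| * G u * G v :=
    intervalIntegral.continuous_parametric_intervalIntegral_of_continuous' (by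
      simp only [Function.uncurry_def]; fun_prop) _ _
  have inner (u : ℝ) : (∫ v in (-1 : ℝ)..1,
        (R u v - r - h * (p * (u + v) + m * |u - v|)) * G u * G v)
      = (∫ v in (-1 : ℝ)..1, R u v * G u * G v)
        - (r * ∫ v in (-1 : ℝ)..1, G v) * G u
        - (h * p * ∫ v in (-1 : ℝ)..1, G v) * (u * G u)
        - (h * p * ∫ v in (-1 : ℝ)..1, v * G v) * G u
        - h * m * ∫ v in (-1 : ℝ)..1, |u - v| * G u * G v := by
    have e : (fun v => (R u v - r - h * (p * (u + v) + m * |u - v|)) * G u * G v)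
        = fun v => R u v * G u * G v - (r * G u) * G v - (h * p * (u * G u)) * G v
          - (h * p * G u) * (v * G v) - (h * m) * (|u - v| * G u * G v) := by
      funext v; ring
    have := hR₁ u
    rw [e, intervalIntegral.integral_sub, intervalIntegral.integral_sub,
      intervalIntegral.integral_sub, intervalIntegral.integral_sub]
    · simp only [intervalIntegral.integral_const_mul]
      ring
    all_goals exact Continuous.intervalIntegrable (by fun_prop) _ _
  simp only [inner]
  rw [intervalIntegral.integral_sub, intervalIntegral.integral_sub,
    intervalIntegral.integral_sub, intervalIntegral.integral_sub]
  · simp only [intervalIntegral.integral_const_mul]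
    ring
  all_goals exact Continuous.intervalIntegrable (by fun_prop) _ _

/-- `integral_integral_expansion_eq` when continuity is only assumed on the square. -/
theorem integral_integral_expansion_eq_of_continuousOn {R : ℝ → ℝ → ℝ} {G : ℝ → ℝ}
    (hR : ContinuousOn (fun q : ℝ × ℝ => R q.1 q.2) (Icc (-1) 1 ×ˢ Icc (-1) 1))
    (hG : ContinuousOn G (Icc (-1) 1)) (r p m h : ℝ) :
    (∫ u in (-1 : ℝ)..1, ∫ v in (-1 : ℝ)..1,
        (R u v - r - h * (p * (u + v) + m * |u - v|)) * G u * G v)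
      = (∫ u in (-1 : ℝ)..1, ∫ v in (-1 : ℝ)..1, R u v * G u * G v)
        - r * (∫ u in (-1 : ℝ)..1, G u) ^ 2
        - h * (2 * p * (∫ u in (-1 : ℝ)..1, G u) * (∫ v in (-1 : ℝ)..1, v * G v)
          + m * ∫ u in (-1 : ℝ)..1, ∫ v in (-1 : ℝ)..1, |u - v| * G u * G v) := by
  have h11 : (-1 : ℝ) ≤ 1 := by norm_num
  let P : ℝ → ℝ := fun u => projIcc (-1 : ℝ) 1 h11 u
  have hPc : Continuous P := continuous_subtype_val.comp continuous_projIcc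
  have hPm (u : ℝ) : P u ∈ Icc (-1 : ℝ) 1 := (projIcc (-1 : ℝ) 1 h11 u).2
  have hP {u : ℝ} (hu : u ∈ uIcc (-1 : ℝ) 1) : P u = u := by
    rw [uIcc_of_le h11] at hu
    exact congrArg Subtype.val (projIcc_of_mem h11 hu)
  have key := integral_integral_expansion_eq (R := fun u v => R (P u) (P v))
    (G := fun u => G (P u))
    (hR.comp_continuous (f := fun q : ℝ × ℝ => (P q.1, P q.2)) (by fun_prop)
      fun q => ⟨hPm _, hPm _⟩)
    (hG.comp_continuous hPc hPm) r p m h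
  have c₁ {f f' : ℝ → ℝ} (hff : ∀ u ∈ uIcc (-1 : ℝ) 1, f u = f' u) :
      (∫ u in (-1 : ℝ)..1, f u) = ∫ u in (-1 : ℝ)..1, f' u :=
    intervalIntegral.integral_congr hff
  have c₂ {f f' : ℝ → ℝ → ℝ}
      (hff : ∀ u ∈ uIcc (-1 : ℝ) 1, ∀ v ∈ uIcc (-1 : ℝ) 1, f u v = f' u v) :
      (∫ u in (-1 : ℝ)..1, ∫ v in (-1 : ℝ)..1, f u v)
        = ∫ u in (-1 : ℝ)..1, ∫ v in (-1 : ℝ)..1, f' u v :=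
    c₁ fun u hu => c₁ (hff u hu)
  have hGP : (∫ u in (-1 : ℝ)..1, G u) = ∫ u in (-1 : ℝ)..1, G (P u) :=
    c₁ fun u hu => by rw [hP hu]
  convert key using 1
  · exact c₂ fun u hu v hv => by rw [hP hu, hP hv]
  · congr 1
    · congr 1
      · exact c₂ fun u hu v hv => by rw [hP hu, hP hv]
      · rw [hGP]
    · congr 2
      · congr 1
        · rw [hGP]
        · exact c₁ fun u hu => by rw [hP hu]
      · congr 1
        exact c₂ fun u hu v hv => by rw [hP hu, hP hv]

/-- eq. (dominated convergence) in the proof of Lemma 1: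
with `ρ` continuous and symmetric on `[0,1]²`, whose partial derivative in the
second variable exists in the interior of each closed triangle `T⁻`, `T⁺` and
extends continuously (extensions `Dm`, `Dp`), `x ∈ (0,1)`, `a⁻ = Dm x x`,
`a⁺ = Dp x x`, and `g` continuous on `[-1,1]`,
`lim_{h→0⁺} h⁻¹ [ ∬ ρ(x+hu,x+hv) g(u) g(v) du dv − ρ(x,x) (∫ g)² ]
  = (a⁺+a⁻)(∫ g)(∫ v g(v) dv) + ((a⁺−a⁻)/2) ∬ |u−v| g(u) g(v) du dv`. -/
theorem stmt_6 (ρ : ℝ → ℝ → ℝ)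
    (hρc : ContinuousOn (fun q : ℝ × ℝ => ρ q.1 q.2) (Icc 0 1 ×ˢ Icc 0 1))
    (hρsym : ∀ s t, s ∈ Icc (0:ℝ) 1 → t ∈ Icc (0:ℝ) 1 → ρ s t = ρ t s)
    (Dm Dp : ℝ → ℝ → ℝ)
    (hDmc : ContinuousOn (fun q : ℝ × ℝ => Dm q.1 q.2)
      {q : ℝ × ℝ | 0 ≤ q.2 ∧ q.2 ≤ q.1 ∧ q.1 ≤ 1})
    (hDm : ∀ s t : ℝ, 0 < t → t < s → s < 1 → HasDerivAt (fun z => ρ s z) (Dm s t) t)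
    (hDpc : ContinuousOn (fun q : ℝ × ℝ => Dp q.1 q.2)
      {q : ℝ × ℝ | 0 ≤ q.1 ∧ q.1 ≤ q.2 ∧ q.2 ≤ 1})
    (hDp : ∀ s t : ℝ, 0 < s → s < t → t < 1 → HasDerivAt (fun z => ρ s z) (Dp s t) t)
    (x : ℝ) (hx : x ∈ Ioo (0:ℝ) 1)
    (g : ℝ → ℝ) (hg : ContinuousOn g (Icc (-1) 1)) :
    Tendsto (fun h : ℝ =>
        ((∫ u in (-1:ℝ)..1, ∫ v in (-1:ℝ)..1, ρ (x + h * u) (x + h * v) * g u * g v)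
          - ρ x x * (∫ u in (-1:ℝ)..1, g u) ^ 2) / h)
      (𝓝[>] (0:ℝ))
      (𝓝 ((Dp x x + Dm x x) * (∫ u in (-1:ℝ)..1, g u) * (∫ v in (-1:ℝ)..1, v * g v)
        + (Dp x x - Dm x x) / 2 * ∫ u in (-1:ℝ)..1, ∫ v in (-1:ℝ)..1, |u - v| * g u * g v)) := by
  obtain ⟨M, hM⟩ := isCompact_Icc.exists_bound_of_continuousOn hg
  have hM0 : 0 ≤ M := (norm_nonneg _).trans (hM 0 (by norm_num))
  rw [Metric.tendsto_nhdsWithin_nhds]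
  intro ε hε
  set η : ℝ := ε / (16 * M ^ 2 + 1) / 2 with hη
  have hη0 : 0 < η := by positivity
  obtain ⟨δ, hδ, hδx, hδx', hexp⟩ :=
    exists_forall_abs_sub_diag_le hρc hDmc hDm hDpc hDp hx hη0
  refine ⟨δ, hδ, fun {h} hh hhδ => ?_⟩
  have hh0 : 0 < h := hh
  rw [Real.dist_eq, sub_zero, abs_of_pos hh0] at hhδ
  have hnear {u : ℝ} (hu : u ∈ Icc (-1 : ℝ) 1) : |h * u| ≤ h := by
    rw [abs_mul, abs_of_pos hh0]
    exact mul_le_of_le_one_right hh0.le (abs_le.2 hu)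
  have hmem {u : ℝ} (hu : u ∈ Icc (-1 : ℝ) 1) : x + h * u ∈ Icc (0 : ℝ) 1 := by
    have := abs_le.1 (hnear hu)
    exact ⟨by linarith, by linarith⟩
  have hR : ContinuousOn (fun q : ℝ × ℝ => ρ (x + h * q.1) (x + h * q.2))
      (Icc (-1) 1 ×ˢ Icc (-1) 1) :=
    hρc.comp (by fun_prop : Continuous fun q : ℝ × ℝ => (x + h * q.1, x + h * q.2)).continuousOn
      fun q hq => ⟨hmem hq.1, hmem hq.2⟩
  have heq := integral_integral_expansion_eq_of_continuousOn
    (R := fun u v => ρ (x + h * u) (x + h * v)) hR hg (ρ x x)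
    ((Dp x x + Dm x x) / 2) ((Dp x x - Dm x x) / 2) h
  have hpt {u v : ℝ} (hu : u ∈ Icc (-1 : ℝ) 1) (hv : v ∈ Icc (-1 : ℝ) 1) :
      |ρ (x + h * u) (x + h * v) - ρ x x
        - h * ((Dp x x + Dm x x) / 2 * (u + v) + (Dp x x - Dm x x) / 2 * |u - v|)|
        ≤ 4 * η * h := by
    have hu' := hnear hu
    have hv' := hnear hv
    have hs : |x + h * u - x| < δ := by rw [add_sub_cancel_left]; linarith
    have ht : |x + h * v - x| < δ := by rw [add_sub_cancel_left]; linarith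
    have hxx : |x - x| < δ := by simpa using hδ
    have e₁ := hexp _ _ hs ht
    have e₂ := hexp _ _ hs hxx
    have e₃ := hexp _ _ hxx hs
    rw [hρsym _ _ ⟨hx.1.le, hx.2.le⟩ (hmem hu)] at e₃
    rw [show x + h * v - (x + h * u) = h * (v - u) by ring, abs_mul, abs_of_pos hh0,
      abs_sub_comm v u] at e₁
    rw [show x - (x + h * u) = -(h * u) by ring, abs_neg] at e₂
    rw [add_sub_cancel_left] at e₃
    have huv : h * |u - v| ≤ 2 * h := by
      rw [mul_comm]
      exact mul_le_mul_of_nonneg_right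
        (abs_le.2 ⟨by linarith [hu.1, hv.2], by linarith [hu.2, hv.1]⟩) hh0.le
    have b₁ := e₁.trans (mul_le_mul_of_nonneg_left huv hη0.le)
    have b₂ := e₂.trans (mul_le_mul_of_nonneg_left hu' hη0.le)
    have b₃ := e₃.trans (mul_le_mul_of_nonneg_left hu' hη0.le)
    rw [abs_le] at b₁ b₂ b₃ ⊢
    constructor <;> linarith [b₁.1, b₁.2, b₂.1, b₂.2, b₃.1, b₃.2]
  have hbound : ‖∫ u in (-1 : ℝ)..1, ∫ v in (-1 : ℝ)..1,
      (ρ (x + h * u) (x + h * v) - ρ x x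
        - h * ((Dp x x + Dm x x) / 2 * (u + v) + (Dp x x - Dm x x) / 2 * |u - v|)) * g u * g v‖
      ≤ 4 * η * h * M * M * |(1 : ℝ) - -1| * |(1 : ℝ) - -1| := by
    have hI {u : ℝ} (hu : u ∈ uIoc (-1 : ℝ) 1) : u ∈ Icc (-1 : ℝ) 1 := by
      rw [uIoc_of_le (by norm_num)] at hu
      exact Ioc_subset_Icc_self hu
    refine intervalIntegral.norm_integral_le_of_norm_le_const fun u hu =>
      intervalIntegral.norm_integral_le_of_norm_le_const fun v hv => ?_
    rw [norm_mul, norm_mul]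
    gcongr
    · exact hpt (hI hu) (hI hv)
    · exact hM u (hI hu)
    · exact hM v (hI hv)
  rw [heq, Real.norm_eq_abs, show |(1 : ℝ) - -1| = 2 by norm_num] at hbound
  rw [Real.dist_eq, div_sub' hh0.ne', abs_div, abs_of_pos hh0, div_lt_iff₀ hh0]
  have hηε : (16 * M ^ 2 + 1) * η = ε / 2 := by rw [hη]; field_simp
  calc _ = _ := by congr 1; ring
    _ ≤ _ := hbound
    _ = (16 * M ^ 2 * η) * h := by ring
    _ < ε * h := by gcongr; linarith
end

section
/- Let p ≥ 0 and ν ∈ {0,…,p} with ν even, x ∈ (0,1), S invertible, and suppose the design is equidistant: x_j = (j−1)/(N−1) for j = 1,…,N. Assume ρ is continuous, symmetric, and twice continuously differentiable on a neighborhood of (x,x), and let (h_N) be positive bandwidths with h_N → 0 and N h_N³ → ∞. With Σ_N = (ρ(x_i,x_j))_{i,j} and V_N = e_νᵀ (X_NᵀW_N X_N)^{-1} X_NᵀW_N Σ_N W_N X_N (X_NᵀW_N X_N)^{-1} e_ν, for all sufficiently large N the matrix X_NᵀW_N X_N is invertible and h_N^{-2} [ h_N^{2ν} V_N − ρ(x,x)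 e_νᵀ S^{-1} S* S^{-1} e_ν − h_N² ρ^{(0,2)}(x,x) e_νᵀ S^{-1} A₁ S^{-1} e_ν ] → 0 as N → ∞, where A₁ is the (p+1)×(p+1) matrix with entries (μ_k μ_{l+2} + μ_{k+2} μ_l)/2 and ρ^{(0,2)} is the second partial derivative of ρ in its second variable. -/
open MeasureTheory Set Filter Topology Matrix

/-- `j`-th moment of the kernel `K`. -/
noncomputable def kmom (K : ℝ → ℝ) (j : ℕ) : ℝ := ∫ u in (-1:ℝ)..1, u ^ j * K u

/-- The matrix `S = (μ_{k+l})`. -/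
noncomputable def Smat (K : ℝ → ℝ) (p : ℕ) : Matrix (Fin (p + 1)) (Fin (p + 1)) ℝ :=
  Matrix.of fun k l => kmom K ((k : ℕ) + (l : ℕ))

/-- The matrix `S* = (μ_k μ_l)`. -/
noncomputable def Sastmat (K : ℝ → ℝ) (p : ℕ) : Matrix (Fin (p + 1)) (Fin (p + 1)) ℝ :=
  Matrix.of fun k l => kmom K (k : ℕ) * kmom K (l : ℕ)

/-- The matrix `A₁ = ((μ_k μ_{l+2} + μ_{k+2} μ_l)/2)`. -/
noncomputable def A1mat (K : ℝ → ℝ) (p : ℕ) : Matrix (Fin (p + 1)) (Fin (p + 1)) ℝ :=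
  Matrix.of fun k l =>
    (kmom K (k : ℕ) * kmom K ((l : ℕ) + 2) + kmom K ((k : ℕ) + 2) * kmom K (l : ℕ)) / 2

/-- Equidistant design points `x_j = (j − 1)/(N − 1)`, `j = 1,…,N`. -/
noncomputable def xdEq (N j : ℕ) : ℝ := ((j : ℝ) - 1) / ((N : ℝ) - 1)

/-- The design matrix `X_N` with `(j,k)` entry `(x_j − x)^k`. -/
noncomputable def Xmat (xd : ℕ → ℕ → ℝ) (x : ℝ) (p N : ℕ) :
    Matrix (Fin N) (Fin (p + 1)) ℝ :=
  Matrix.of fun j k => (xd N ((j : ℕ) + 1) - x) ^ (k : ℕ)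

/-- The weight matrix `W_N = diag(h⁻¹ K((x_j − x)/h))`. -/
noncomputable def Wmat (K : ℝ → ℝ) (xd : ℕ → ℕ → ℝ) (x h : ℝ) (N : ℕ) :
    Matrix (Fin N) (Fin N) ℝ :=
  Matrix.diagonal fun j => h⁻¹ * K ((xd N ((j : ℕ) + 1) - x) / h)

/-- The covariance matrix `Σ_N = (ρ(x_i, x_j))`. -/
noncomputable def Sigmat (ρ : ℝ → ℝ → ℝ) (xd : ℕ → ℕ → ℝ) (N : ℕ) :
    Matrix (Fin N) (Fin N) ℝ :=
  Matrix.of fun i j => ρ (xd N ((i : ℕ) + 1)) (xd N ((j : ℕ) + 1))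

/-- The normalized variance `V_N = e_νᵀ (XᵀWX)⁻¹ XᵀW Σ_N W X (XᵀWX)⁻¹ e_ν`. -/
noncomputable def VN (K : ℝ → ℝ) (xd : ℕ → ℕ → ℝ) (ρ : ℝ → ℝ → ℝ) (x h : ℝ)
    (p N : ℕ) (ν : Fin (p + 1)) : ℝ :=
  (((Xmat xd x p N)ᵀ * Wmat K xd x h N * Xmat xd x p N)⁻¹ *
    ((Xmat xd x p N)ᵀ * Wmat K xd x h N) * Sigmat ρ xd N *
    (Wmat K xd x h N * Xmat xd x p N) *
    ((Xmat xd x p N)ᵀ * Wmat K xd x h N * Xmat xd x p N)⁻¹) ν ν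

/-- **Second-order Taylor formula** with Peano remainder on a real normed space. -/
theorem ContDiffAt.eventually_taylor_two_remainder_le {E : Type*} [NormedAddCommGroup E]
    [NormedSpace ℝ E] {f : E → ℝ} {q : E} (hf : ContDiffAt ℝ 2 f q) {ε : ℝ} (hε : 0 < ε) :
    ∀ᶠ v in 𝓝 (0 : E),
      |f (q + v) - f q - fderiv ℝ f q v - fderiv ℝ (fderiv ℝ f) q v v / 2| ≤ ε * ‖v‖ ^ 2 := by
  have hd : ∀ᶠ y in 𝓝 q, DifferentiableAt ℝ f y :=
    (hf.eventually (by simp)).mono fun y hy => hy.differentiableAt (by simp)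
  have hd2 : HasFDerivAt (fderiv ℝ f) (fderiv ℝ (fderiv ℝ f) q) q :=
    ((hf.fderiv_right (m := 1) (by norm_num)).differentiableAt (by simp)).hasFDerivAt
  have hlo := hd2.isLittleO.def hε
  obtain ⟨r, hr, hball⟩ := Metric.eventually_nhds_iff_ball.1 (hd.and hlo)
  filter_upwards [Metric.ball_mem_nhds (0 : E) hr] with v hv
  rw [mem_ball_zero_iff] at hv
  have hmem : ∀ t ∈ Icc (0 : ℝ) 1, q + t • v ∈ Metric.ball q r := by
    intro t ht
    rw [mem_ball_iff_norm, add_sub_cancel_left, norm_smul, Real.norm_of_nonneg ht.1]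
    nlinarith [norm_nonneg v, ht.2]
  have hline : ∀ t : ℝ, HasDerivAt (fun t : ℝ => q + t • v) v t := fun t => by
    simpa using ((hasDerivAt_id t).smul_const v).const_add q
  have hder : ∀ t ∈ Icc (0 : ℝ) 1, HasDerivWithinAt
      (fun t : ℝ => f (q + t • v) - t * fderiv ℝ f q v - t ^ 2 * (fderiv ℝ (fderiv ℝ f) q v v / 2))
      (fderiv ℝ f (q + t • v) v - fderiv ℝ f q v - t * fderiv ℝ (fderiv ℝ f) q v v)
      (Icc 0 1) t := by
    intro t ht
    have h1 := ((hball _ (hmem t ht)).1.hasFDerivAt).comp_hasDerivAt t (hline t)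
    have h2 := (hasDerivAt_id t).mul_const (fderiv ℝ f q v)
    have h3 := (hasDerivAt_pow 2 t).mul_const (fderiv ℝ (fderiv ℝ f) q v v / 2)
    refine (((h1.sub h2).sub h3).congr_deriv ?_).hasDerivWithinAt
    simp
    ring
  have hbd : ∀ t ∈ Ico (0 : ℝ) 1,
      ‖fderiv ℝ f (q + t • v) v - fderiv ℝ f q v - t * fderiv ℝ (fderiv ℝ f) q v v‖
        ≤ ε * ‖v‖ ^ 2 := by
    intro t ht
    have h := (hball _ (hmem t ⟨ht.1, ht.2.le⟩)).2
    simp only [add_sub_cancel_left] at h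
    have h1 : fderiv ℝ f (q + t • v) v - fderiv ℝ f q v - t * fderiv ℝ (fderiv ℝ f) q v v
        = (fderiv ℝ f (q + t • v) - fderiv ℝ f q - fderiv ℝ (fderiv ℝ f) q (t • v)) v := by
      simp
    rw [h1]
    refine (ContinuousLinearMap.le_opNorm _ _).trans ?_
    have h2 : ‖t • v‖ ≤ ‖v‖ := by
      rw [norm_smul, Real.norm_of_nonneg ht.1]
      nlinarith [norm_nonneg v, ht.2]
    calc _ ≤ (ε * ‖t • v‖) * ‖v‖ := by gcongr
      _ ≤ (ε * ‖v‖) * ‖v‖ := by gcongr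
      _ = _ := by ring
  have h := norm_image_sub_le_of_norm_deriv_le_segment_01' hder hbd
  simp only [Real.norm_eq_abs] at h
  convert h using 2
  simp
  ring

/-- The second derivative of `f` along a line is the second Fréchet derivative on the diagonal. -/
theorem ContDiffAt.iteratedDeriv_two_comp_line {E : Type*} [NormedAddCommGroup E]
    [NormedSpace ℝ E] {f : E → ℝ} {c : ℝ → E} {e : E} {x : ℝ}
    (hc : ∀ t, HasDerivAt c e t) (hf : ContDiffAt ℝ 2 f (c x)) :
    iteratedDeriv 2 (fun t => f (c t)) x = fderiv ℝ (fderiv ℝ f) (c x) e e := by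
  have hd : ∀ᶠ t in 𝓝 x, deriv (fun t => f (c t)) t = fderiv ℝ f (c t) e := by
    have h := (hc x).continuousAt.eventually (hf.eventually (by simp))
    filter_upwards [h] with t ht
    exact ((ht.differentiableAt (by simp)).hasFDerivAt.comp_hasDerivAt t (hc t)).deriv
  have hd2 : HasFDerivAt (fderiv ℝ f) (fderiv ℝ (fderiv ℝ f) (c x)) (c x) :=
    ((hf.fderiv_right (m := 1) (by norm_num)).differentiableAt (by simp)).hasFDerivAt
  rw [show (2 : ℕ) = 1 + 1 from rfl, iteratedDeriv_succ, iteratedDeriv_one,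
    Filter.EventuallyEq.deriv_eq hd]
  have h := (hd2.comp_hasDerivAt x (hc x)).clm_apply (hasDerivAt_const x e)
  simpa using h.deriv

/-- Multiplying a Lipschitz function supported in `[-1, 1]` by a power keeps it Lipschitz. -/
theorem exists_lipschitz_pow_mul {g : ℝ → ℝ} (hg : ∃ C, ∀ s t, |g s - g t| ≤ C * |s - t|)
    (hsupp : ∀ u, u ∉ Icc (-1:ℝ) 1 → g u = 0) (a : ℕ) :
    ∃ C, ∀ s t, |s ^ a * g s - t ^ a * g t| ≤ C * |s - t| := by
  induction a with
  | zero => simpa using hg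
  | succ a ih =>
    obtain ⟨C, hC⟩ := ih
    set k : ℝ → ℝ := fun u => u ^ a * g u with hk
    have hk0 : ∀ u, u ∉ Icc (-1:ℝ) 1 → k u = 0 := fun u hu => by simp [hk, hsupp u hu]
    have hC0 : 0 ≤ C := by simpa using (abs_nonneg _).trans (hC 1 0)
    have hb : ∀ u, |k u| ≤ 3 * C := by
      intro u
      by_cases hu : u ∈ Icc (-1:ℝ) 1
      · have h := hC u 2
        change |k u - k 2| ≤ _ at h
        rw [hk0 2 (by norm_num), sub_zero] at h
        have : |u - 2| ≤ 3 := by rw [abs_le]; constructor <;> linarith [hu.1, hu.2]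
        nlinarith
      · rw [hk0 u hu]; simpa using hC0
    have key : ∀ s ∈ Icc (-1:ℝ) 1, ∀ t, |s * k s - t * k t| ≤ 4 * C * |s - t| := by
      intro s hs t
      have h1 : s * k s - t * k t = s * (k s - k t) + (s - t) * k t := by ring
      rw [h1]
      refine (abs_add_le _ _).trans ?_
      rw [abs_mul, abs_mul]
      have h2 : |s| ≤ 1 := abs_le.2 hs
      have h3 : |k s - k t| ≤ C * |s - t| := hC s t
      have h4 := hb t
      nlinarith [abs_nonneg (s - t), abs_nonneg (k s - k t), abs_nonneg (k t),
        mul_le_mul_of_nonneg_left h4 (abs_nonneg (s - t)),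
        mul_le_mul_of_nonneg_right h2 (abs_nonneg (k s - k t))]
    refine ⟨4 * C, fun s t => ?_⟩
    have e : ∀ u, u ^ (a + 1) * g u = u * k u := fun u => by simp only [hk]; ring
    rw [e, e]
    by_cases hs : s ∈ Icc (-1:ℝ) 1
    · exact key s hs t
    by_cases ht : t ∈ Icc (-1:ℝ) 1
    · rw [abs_sub_comm, abs_sub_comm s t]; exact key t ht s
    · rw [hk0 s hs, hk0 t ht]; simp; positivity

/-- Left Riemann sums of a Lipschitz function supported in `[-1, 1]` have error of the order of the
mesh, uniformly in the number of nodes. -/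
theorem abs_riemann_sum_sub_integral_le {g : ℝ → ℝ} {C : ℝ}
    (hg : ∀ s t, |g s - g t| ≤ C * |s - t|) (hsupp : ∀ u, u ∉ Icc (-1:ℝ) 1 → g u = 0)
    {δ : ℝ} (hδ0 : 0 ≤ δ) (hδ1 : δ ≤ 1) (a : ℝ) (n : ℕ) :
    |δ * ∑ j ∈ Finset.range n, g (a + j * δ) - ∫ u in a..(a + n * δ), g u|
      ≤ 5 * Real.pi * C * δ := by
  have hC0 : 0 ≤ C := by simpa using (abs_nonneg _).trans (hg 1 0)
  have hcont : Continuous g :=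
    (LipschitzWith.of_dist_le_mul (K := ⟨C, hC0⟩) fun s t => by
      rw [Real.dist_eq, Real.dist_eq]; exact hg s t).continuous
  set b : ℕ → ℝ := fun j => a + j * δ with hb
  have hbs : ∀ j, b (j + 1) = b j + δ := fun j => by simp only [hb]; push_cast; ring
  set φ : ℝ → ℝ := fun s => 5 * C * δ * (1 + s ^ 2)⁻¹ with hφ
  have hφc : Continuous φ := by
    have : Continuous fun s : ℝ => (1 + s ^ 2)⁻¹ :=
      Continuous.inv₀ (by fun_prop) fun s => by positivity
    exact continuous_const.mul this
  have hloc : ∀ j, |δ * g (b j) - ∫ u in (b j)..(b (j + 1)), g u|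
      ≤ ∫ u in (b j)..(b (j + 1)), φ u := by
    intro j
    have hle : b j ≤ b (j + 1) := by rw [hbs]; linarith
    have h1 : δ * g (b j) = ∫ u in (b j)..(b (j + 1)), g (b j) := by
      rw [intervalIntegral.integral_const, hbs]; simp
    rw [h1, ← intervalIntegral.integral_sub (by simp) (hcont.intervalIntegrable _ _),
      ← Real.norm_eq_abs]
    refine intervalIntegral.norm_integral_le_of_norm_le hle ?_ (hφc.intervalIntegrable _ _)
    refine Filter.Eventually.of_forall fun s hs => ?_
    rw [hbs] at hs
    rw [Real.norm_eq_abs]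
    have hd : |b j - s| ≤ δ := by rw [abs_le]; constructor <;> linarith [hs.1, hs.2]
    by_cases h2 : s ∈ Icc (-2:ℝ) 2
    · have h3 : |g (b j) - g s| ≤ C * δ := (hg _ _).trans (by gcongr)
      have h4 : 1 ≤ 5 * (1 + s ^ 2)⁻¹ := by
        rw [← div_eq_mul_inv, le_div_iff₀ (by positivity)]
        nlinarith [h2.1, h2.2]
      have h5 : 0 ≤ C * δ := by positivity
      simp only [hφ]
      nlinarith
    · have hs0 : g s = 0 := hsupp s fun h => h2 ⟨by linarith [h.1], by linarith [h.2]⟩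
      have hb0 : g (b j) = 0 := hsupp _ fun h => h2
        ⟨by linarith [h.1, hs.1], by linarith [h.2, hs.2]⟩
      rw [hs0, hb0]
      simp only [hφ, sub_zero, abs_zero]
      positivity
  have hsum : ∫ u in a..(a + n * δ), g u
      = ∑ j ∈ Finset.range n, ∫ u in (b j)..(b (j + 1)), g u := by
    rw [intervalIntegral.sum_integral_adjacent_intervals
      fun k _ => hcont.intervalIntegrable _ _]
    simp [hb]
  have hφsum : ∑ j ∈ Finset.range n, ∫ u in (b j)..(b (j + 1)), φ u ≤ 5 * Real.pi * C * δ := by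
    rw [intervalIntegral.sum_integral_adjacent_intervals
      fun k _ => hφc.intervalIntegrable _ _]
    simp only [hφ, intervalIntegral.integral_const_mul, integral_inv_one_add_sq]
    have h1 := Real.arctan_lt_pi_div_two (b n)
    have h2 := Real.neg_pi_div_two_lt_arctan (b 0)
    have h3 : 0 ≤ 5 * C * δ := by positivity
    nlinarith
  rw [hsum, Finset.mul_sum, ← Finset.sum_sub_distrib]
  exact (Finset.abs_sum_le_sum_abs _ _).trans ((Finset.sum_le_sum fun j _ => hloc j).trans hφsum)

/-- The rescaled design point `(x_{j+1} − x)/h` of the equidistant design. -/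
noncomputable def scaledNode (x h : ℝ) (N j : ℕ) : ℝ := (xdEq N (j + 1) - x) / h

/-- The empirical kernel moment, a Riemann sum for `kmom K a`. -/
noncomputable def empMom (K : ℝ → ℝ) (x h : ℝ) (N a : ℕ) : ℝ :=
  (((N : ℝ) - 1) * h)⁻¹ * ∑ j : Fin N, scaledNode x h N j ^ a * K (scaledNode x h N j)

/-- The Hankel matrix of empirical kernel moments. -/
noncomputable def empSmat (K : ℝ → ℝ) (x h : ℝ) (p N : ℕ) :
    Matrix (Fin (p + 1)) (Fin (p + 1)) ℝ :=
  Matrix.of fun k l => empMom K x h N ((k : ℕ) + (l : ℕ))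

/-- The weight of the `i`-th observation in the `ν`-th local polynomial coefficient, in rescaled
coordinates. -/
noncomputable def empWeight (K : ℝ → ℝ) (x h : ℝ) (p N : ℕ) (ν : Fin (p + 1)) (i : ℕ) : ℝ :=
  (((N : ℝ) - 1) * h)⁻¹ *
    ∑ k, (empSmat K x h p N)⁻¹ ν k * (scaledNode x h N i ^ (k : ℕ) * K (scaledNode x h N i))

section Design

variable {K : ℝ → ℝ} {x h : ℝ} {p N : ℕ}

theorem xdEq_sub_eq (hh : 0 < h) (j : ℕ) : xdEq N (j + 1) - x = h * scaledNode x h N j := by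
  unfold scaledNode
  field_simp

theorem support_subset_Ioo_of_continuous {g : ℝ → ℝ} (hg : Continuous g) {a b : ℝ}
    (hsupp : ∀ u, u ∉ Icc a b → g u = 0) : Function.support g ⊆ Ioo a b := by
  rw [← interior_Icc]
  refine interior_maximal (fun u hu => ?_) hg.isOpen_support
  by_contra h
  exact hu (hsupp u h)

theorem abs_empMom_sub_kmom_le (hK : Continuous K)
    (hKsupp : ∀ u, u ∉ Icc (-1:ℝ) 1 → K u = 0) {a : ℕ} {C : ℝ}
    (hC : ∀ s t, |s ^ a * K s - t ^ a * K t| ≤ C * |s - t|)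
    (hh : 0 < h) (hhx : h < x) (hhx' : h < 1 - x) (hN : 2 ≤ N)
    (hδ : (((N : ℝ) - 1) * h)⁻¹ ≤ 1) :
    |empMom K x h N a - kmom K a| ≤ 5 * Real.pi * C * (((N : ℝ) - 1) * h)⁻¹ := by
  obtain ⟨n, rfl⟩ : ∃ n, N = n + 1 := ⟨N - 1, by omega⟩
  have hn : (0:ℝ) < n := by exact_mod_cast (by omega : 0 < n)
  have hcast : ((n + 1 : ℕ) : ℝ) - 1 = n := by push_cast; ring
  have hsupp : ∀ u, u ∉ Icc (-1:ℝ) 1 → u ^ a * K u = 0 := fun u hu => by simp [hKsupp u hu]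
  have hcont : Continuous fun u => u ^ a * K u := by fun_prop
  have hlo : -x / h < -1 := by rw [div_lt_iff₀ hh]; linarith
  have hhi : 1 < (1 - x) / h := by rw [lt_div_iff₀ hh]; linarith
  have hnode : ∀ j : ℕ, scaledNode x h (n + 1) j = -x / h + j * ((n : ℝ) * h)⁻¹ := by
    intro j
    simp only [scaledNode, xdEq, hcast]
    push_cast
    field_simp
    ring
  have hend : -x / h + n * ((n : ℝ) * h)⁻¹ = (1 - x) / h := by
    field_simp
    ring
  have hss := support_subset_Ioo_of_continuous hcont hsupp
  have hint : kmom K a = ∫ u in (-x / h)..((1 - x) / h), u ^ a * K u := by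
    unfold kmom
    rw [intervalIntegral.integral_eq_integral_of_support_subset
        (hss.trans Ioo_subset_Ioc_self),
      intervalIntegral.integral_eq_integral_of_support_subset
        (hss.trans ((Ioo_subset_Ioo hlo.le hhi.le).trans Ioo_subset_Ioc_self))]
  rw [hcast] at hδ ⊢
  have hR := abs_riemann_sum_sub_integral_le hC hsupp (by positivity) hδ (-x / h) n
  rw [hend, ← hint] at hR
  have hsum : empMom K x h (n + 1) a = ((n : ℝ) * h)⁻¹ * ∑ j ∈ Finset.range n,
      ((-x / h + j * ((n : ℝ) * h)⁻¹) ^ a * K (-x / h + j * ((n : ℝ) * h)⁻¹)) := by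
    unfold empMom
    rw [Fin.sum_univ_eq_sum_range
      (fun j => scaledNode x h (n + 1) j ^ a * K (scaledNode x h (n + 1) j)) (n + 1),
      Finset.sum_range_succ, hcast]
    simp only [hnode]
    rw [hend, hsupp _ fun h => absurd h.2 (not_le.2 hhi), add_zero]
  rw [hsum]
  exact hR

theorem transpose_mul_Wmat_mul_Xmat (hh : 0 < h) (hN : 2 ≤ N) :
    (Xmat xdEq x p N)ᵀ * Wmat K xdEq x h N * Xmat xdEq x p N =
      ((N : ℝ) - 1) • (Matrix.diagonal (fun k : Fin (p + 1) => h ^ (k : ℕ)) * empSmat K x h p N *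
        Matrix.diagonal (fun k : Fin (p + 1) => h ^ (k : ℕ))) := by
  have hN1 : (0:ℝ) < (N : ℝ) - 1 := by
    have : (2:ℝ) ≤ N := by exact_mod_cast hN
    linarith
  ext k l
  rw [Matrix.mul_apply]
  simp only [Wmat, Matrix.smul_apply, Matrix.mul_diagonal, Matrix.diagonal_mul, empSmat, empMom,
    Matrix.of_apply, smul_eq_mul, Matrix.transpose_apply, Xmat,
    xdEq_sub_eq hh, Finset.mul_sum, Finset.sum_mul]
  refine Finset.sum_congr rfl fun j _ => ?_
  rw [mul_div_cancel_left₀ _ hh.ne']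
  field_simp
  ring

theorem pow_mul_inv_mul_apply (hh : 0 < h) (hN : 2 ≤ N) (ν : Fin (p + 1)) (i : Fin N) :
    h ^ (ν : ℕ) * (((Xmat xdEq x p N)ᵀ * Wmat K xdEq x h N * Xmat xdEq x p N)⁻¹ *
      ((Xmat xdEq x p N)ᵀ * Wmat K xdEq x h N)) ν i = empWeight K x h p N ν i := by
  have hN1 : (0:ℝ) < (N : ℝ) - 1 := by
    have : (2:ℝ) ≤ N := by exact_mod_cast hN
    linarith
  have hD : (Matrix.diagonal (fun k : Fin (p + 1) => h ^ (k : ℕ)))⁻¹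
      = Matrix.diagonal (fun k : Fin (p + 1) => (h ^ (k : ℕ))⁻¹) := by
    refine Matrix.inv_eq_left_inv ?_
    rw [Matrix.diagonal_mul_diagonal, ← Matrix.diagonal_one]
    congr 1
    ext k
    exact inv_mul_cancel₀ (by positivity)
  have hinv : ((Xmat xdEq x p N)ᵀ * Wmat K xdEq x h N * Xmat xdEq x p N)⁻¹
      = ((N : ℝ) - 1)⁻¹ • (Matrix.diagonal (fun k : Fin (p + 1) => (h ^ (k : ℕ))⁻¹) *
        ((empSmat K x h p N)⁻¹ * Matrix.diagonal (fun k : Fin (p + 1) => (h ^ (k : ℕ))⁻¹))) := by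
    rw [transpose_mul_Wmat_mul_Xmat hh hN]
    set M := Matrix.diagonal (fun k : Fin (p + 1) => h ^ (k : ℕ)) * empSmat K x h p N *
        Matrix.diagonal (fun k : Fin (p + 1) => h ^ (k : ℕ)) with hM
    have h1 : ((N : ℝ) - 1) • M = ((N : ℝ) - 1) • (1 : Matrix _ _ ℝ) * M := by simp
    have h2 : (((N : ℝ) - 1) • (1 : Matrix (Fin (p + 1)) (Fin (p + 1)) ℝ))⁻¹
        = ((N : ℝ) - 1)⁻¹ • 1 := by
      refine Matrix.inv_eq_left_inv ?_
      rw [smul_mul_smul_comm, inv_mul_cancel₀ hN1.ne']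
      simp
    rw [h1, Matrix.mul_inv_rev, h2, hM, Matrix.mul_inv_rev, Matrix.mul_inv_rev, hD]
    simp
  rw [hinv, Matrix.mul_apply]
  simp only [Wmat, Matrix.smul_apply, Matrix.mul_diagonal, Matrix.diagonal_mul,
    Matrix.transpose_apply, Xmat, Matrix.of_apply, smul_eq_mul, xdEq_sub_eq hh, empWeight,
    Finset.mul_sum]
  refine Finset.sum_congr rfl fun k _ => ?_
  rw [mul_div_cancel_left₀ _ hh.ne', mul_pow]
  field_simp

theorem pow_mul_VN_eq {ρ : ℝ → ℝ → ℝ} (hh : 0 < h) (hN : 2 ≤ N) (ν : Fin (p + 1)) :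
    h ^ (2 * (ν : ℕ)) * VN K xdEq ρ x h p N ν =
      ∑ i : Fin N, ∑ j : Fin N, empWeight K x h p N ν i * empWeight K x h p N ν j *
        ρ (x + h * scaledNode x h N i) (x + h * scaledNode x h N j) := by
  set G := (Xmat xdEq x p N)ᵀ * Wmat K xdEq x h N * Xmat xdEq x p N with hG
  have hW : (Wmat K xdEq x h N)ᵀ = Wmat K xdEq x h N := Matrix.diagonal_transpose _
  have hGt : Gᵀ = G := by
    rw [hG, Matrix.transpose_mul, Matrix.transpose_mul, hW, Matrix.transpose_transpose,
      Matrix.mul_assoc]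
  have hA : Wmat K xdEq x h N * Xmat xdEq x p N * G⁻¹
      = (G⁻¹ * ((Xmat xdEq x p N)ᵀ * Wmat K xdEq x h N))ᵀ := by
    rw [Matrix.transpose_mul, Matrix.transpose_mul, hW, Matrix.transpose_transpose,
      Matrix.transpose_nonsing_inv, hGt]
  have hV : VN K xdEq ρ x h p N ν = ((G⁻¹ * ((Xmat xdEq x p N)ᵀ * Wmat K xdEq x h N)) *
      Sigmat ρ xdEq N * (G⁻¹ * ((Xmat xdEq x p N)ᵀ * Wmat K xdEq x h N))ᵀ) ν ν := by
    rw [← hA, VN, ← hG]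
    simp only [Matrix.mul_assoc]
  rw [hV, Matrix.mul_apply, Finset.sum_comm, Finset.mul_sum]
  refine Finset.sum_congr rfl fun j _ => ?_
  rw [Matrix.mul_apply, Finset.sum_mul, Finset.mul_sum]
  refine Finset.sum_congr rfl fun i _ => ?_
  rw [← pow_mul_inv_mul_apply hh hN ν i, ← pow_mul_inv_mul_apply hh hN ν j, ← hG,
    Matrix.transpose_apply, Sigmat, Matrix.of_apply, ← xdEq_sub_eq hh, ← xdEq_sub_eq hh,
    add_sub_cancel, add_sub_cancel]
  ring

theorem sum_empWeight_mul_pow (ν : Fin (p + 1)) (r : ℕ) :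
    ∑ i : Fin N, empWeight K x h p N ν i * scaledNode x h N i ^ r =
      ∑ k, (empSmat K x h p N)⁻¹ ν k * empMom K x h N ((k : ℕ) + r) := by
  simp only [empWeight, empMom, Finset.mul_sum, Finset.sum_mul]
  rw [Finset.sum_comm]
  refine Finset.sum_congr rfl fun k _ => Finset.sum_congr rfl fun i _ => ?_
  rw [pow_add]
  ring

theorem abs_empWeight_le (hKnn : ∀ u, 0 ≤ K u) (hKsupp : ∀ u, u ∉ Icc (-1:ℝ) 1 → K u = 0)
    (hh : 0 < h) (hN : 2 ≤ N) (ν : Fin (p + 1)) (i : ℕ) :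
    |empWeight K x h p N ν i| ≤ (∑ k, |(empSmat K x h p N)⁻¹ ν k|) *
      ((((N : ℝ) - 1) * h)⁻¹ * K (scaledNode x h N i)) := by
  have hN1 : (0:ℝ) < (N : ℝ) - 1 := by
    have : (2:ℝ) ≤ N := by exact_mod_cast hN
    linarith
  set u := scaledNode x h N i with hu
  have hpow : ∀ k : ℕ, |u ^ k * K u| ≤ K u := by
    intro k
    by_cases hm : u ∈ Icc (-1:ℝ) 1
    · rw [abs_mul, abs_pow, abs_of_nonneg (hKnn u)]
      exact mul_le_of_le_one_left (hKnn u) (pow_le_one₀ (abs_nonneg _) (abs_le.2 hm))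
    · simp [hKsupp u hm]
  rw [empWeight, abs_mul, abs_of_pos (by positivity : 0 < (((N : ℝ) - 1) * h)⁻¹),
    mul_left_comm, Finset.sum_mul]
  refine mul_le_mul_of_nonneg_left ?_ (by positivity)
  refine (Finset.abs_sum_le_sum_abs _ _).trans (Finset.sum_le_sum fun k _ => ?_)
  rw [abs_mul]
  exact mul_le_mul_of_nonneg_left (hpow k) (abs_nonneg _)

end Design

/-- A double sum against product weights of a function with quadratic expansion splits into the
moments of the weights and a remainder controlled by the mass of a dominating weight. -/
theorem abs_sum_sum_mul_sub_quadratic_le {ι : Type*} [Fintype ι] (w κ u : ι → ℝ) (r : ι → ι → ℝ)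
    {c₀ α β a b c η A : ℝ} (hw : ∀ i, |w i| ≤ A * κ i)
    (hr : ∀ i j, κ i ≠ 0 → κ j ≠ 0 →
      |r i j - (c₀ + (α * u i + β * u j)
        + (a * u i ^ 2 + b * (u i * u j) + c * u j ^ 2))| ≤ η) :
    |∑ i, ∑ j, w i * w j * r i j -
        (c₀ * (∑ i, w i * u i ^ 0) ^ 2
          + (α + β) * ((∑ i, w i * u i ^ 0) * ∑ i, w i * u i ^ 1)
          + ((a + c) * ((∑ i, w i * u i ^ 0) * ∑ i, w i * u i ^ 2)
            + b * (∑ i, w i * u i ^ 1) ^ 2))| ≤ η * (A * ∑ i, κ i) ^ 2 := by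
  have key : ∑ i, ∑ j, w i * w j * r i j -
        (c₀ * (∑ i, w i * u i ^ 0) ^ 2
          + (α + β) * ((∑ i, w i * u i ^ 0) * ∑ i, w i * u i ^ 1)
          + ((a + c) * ((∑ i, w i * u i ^ 0) * ∑ i, w i * u i ^ 2)
            + b * (∑ i, w i * u i ^ 1) ^ 2)) =
      ∑ i, ∑ j, w i * w j * (r i j - (c₀ + (α * u i + β * u j)
        + (a * u i ^ 2 + b * (u i * u j) + c * u j ^ 2))) := by
    have hprod : ∀ m n : ℕ, (∑ i, w i * u i ^ m) * ∑ i, w i * u i ^ n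
        = ∑ i, ∑ j, w i * w j * (u i ^ m * u j ^ n) := fun m n => by
      rw [Finset.sum_mul_sum]
      exact Finset.sum_congr rfl fun i _ => Finset.sum_congr rfl fun j _ => by ring
    have e : ∀ z₀ z₁ z₂ : ℝ, c₀ * z₀ ^ 2 + (α + β) * (z₀ * z₁)
        + ((a + c) * (z₀ * z₂) + b * z₁ ^ 2) =
        c₀ * (z₀ * z₀) + α * (z₁ * z₀) + β * (z₀ * z₁) + a * (z₂ * z₀) + b * (z₁ * z₁)
          + c * (z₀ * z₂) := fun _ _ _ => by ring
    rw [e]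
    simp only [hprod, Finset.mul_sum, ← Finset.sum_add_distrib, ← Finset.sum_sub_distrib]
    exact Finset.sum_congr rfl fun i _ => Finset.sum_congr rfl fun j _ => by ring
  rw [key]
  have hsq : η * (A * ∑ i, κ i) ^ 2 = ∑ i, ∑ j, (A * κ i) * (A * κ j) * η := by
    rw [sq, Finset.mul_sum, Finset.sum_mul_sum, Finset.mul_sum]
    refine Finset.sum_congr rfl fun i _ => ?_
    rw [Finset.mul_sum]
    exact Finset.sum_congr rfl fun j _ => by ring
  rw [hsq]
  refine (Finset.abs_sum_le_sum_abs _ _).trans (Finset.sum_le_sum fun i _ => ?_)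
  refine (Finset.abs_sum_le_sum_abs _ _).trans (Finset.sum_le_sum fun j _ => ?_)
  have hi := (abs_nonneg _).trans (hw i)
  have hj := (abs_nonneg _).trans (hw j)
  rw [abs_mul, abs_mul]
  by_cases h1 : κ i = 0
  · have h0 : |w i| = 0 := le_antisymm (by simpa [h1] using hw i) (abs_nonneg _)
    rw [h0]; simp [h1]
  by_cases h2 : κ j = 0
  · have h0 : |w j| = 0 := le_antisymm (by simpa [h2] using hw j) (abs_nonneg _)
    rw [h0]; simp [h2]
  exact mul_le_mul (mul_le_mul (hw i) (hw j) (abs_nonneg _) hi) (hr i j h1 h2) (abs_nonneg _)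
    (mul_nonneg hi hj)

section Limits

variable {K : ℝ → ℝ} {x : ℝ} {p : ℕ} {hN : ℕ → ℝ}

theorem tendsto_inv_mesh_div_sq (hN0 : Tendsto hN atTop (𝓝 0))
    (hNh3 : Tendsto (fun N : ℕ => (N : ℝ) * hN N ^ 3) atTop atTop) :
    Tendsto (fun N : ℕ => (((N : ℝ) - 1) * hN N)⁻¹ / hN N ^ 2) atTop (𝓝 0) := by
  have h3 : Tendsto (fun N => -hN N ^ 3) atTop (𝓝 0) := by simpa using (hN0.pow 3).neg
  have h := (hNh3.atTop_add h3).inv_tendsto_atTop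
  refine h.congr fun N => ?_
  simp only [Pi.inv_apply]
  rw [div_eq_mul_inv, ← mul_inv]
  congr 1
  ring

theorem tendsto_empMom_sub_kmom_div_sq {L : NNReal} (hKlip : LipschitzWith L K)
    (hKsupp : ∀ u, u ∉ Icc (-1:ℝ) 1 → K u = 0) (hx : x ∈ Ioo (0:ℝ) 1)
    (hNpos : ∀ N, 0 < hN N) (hN0 : Tendsto hN atTop (𝓝 0))
    (hNh3 : Tendsto (fun N : ℕ => (N : ℝ) * hN N ^ 3) atTop atTop) (a : ℕ) :
    Tendsto (fun N => (empMom K x (hN N) N a - kmom K a) / hN N ^ 2) atTop (𝓝 0) := by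
  obtain ⟨C, hC⟩ := exists_lipschitz_pow_mul (g := K)
    ⟨L, fun s t => by simpa [Real.dist_eq] using hKlip.dist_le_mul s t⟩ hKsupp a
  have hδ := tendsto_inv_mesh_div_sq hN0 hNh3
  have hδ0 : Tendsto (fun N : ℕ => (((N : ℝ) - 1) * hN N)⁻¹) atTop (𝓝 0) := by
    have h := hδ.mul (hN0.pow 2)
    rw [zero_mul] at h
    exact h.congr fun N => div_mul_cancel₀ _ (pow_ne_zero 2 (hNpos N).ne')
  have hlim : Tendsto (fun N : ℕ => 5 * Real.pi * C * ((((N : ℝ) - 1) * hN N)⁻¹ / hN N ^ 2))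
      atTop (𝓝 0) := by simpa using hδ.const_mul (5 * Real.pi * C)
  refine squeeze_zero_norm' ?_ hlim
  filter_upwards [hN0.eventually_lt_const hx.1, hN0.eventually_lt_const (sub_pos.2 hx.2),
    eventually_ge_atTop 2, hδ0.eventually_le_const one_pos] with N h1 h2 h3 h4
  have hp := hNpos N
  rw [Real.norm_eq_abs, abs_div, abs_of_pos (pow_pos hp 2), ← mul_div_assoc]
  gcongr
  exact abs_empMom_sub_kmom_le hKlip.continuous hKsupp hC hp h1 h2 h3 h4

theorem kmom_odd_eq_zero (hKsym : ∀ u, K (-u) = K u) {j : ℕ} (hj : Odd j) : kmom K j = 0 := by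
  have h : kmom K j = -kmom K j := by
    conv_lhs => rw [kmom, ← neg_neg (1:ℝ), ← intervalIntegral.integral_comp_neg]
    rw [kmom, ← intervalIntegral.integral_neg, neg_neg]
    congr 1
    ext u
    rw [hj.neg_pow, hKsym]
    ring
  linarith

/-- For a symmetric kernel the inverse moment matrix has checkerboard structure. -/
theorem Smat_inv_apply_eq_zero (hKsym : ∀ u, K (-u) = K u) {k l : Fin (p + 1)}
    (hkl : Odd ((k : ℕ) + (l : ℕ))) : (Smat K p)⁻¹ k l = 0 := by
  set J : Matrix (Fin (p + 1)) (Fin (p + 1)) ℝ :=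
    Matrix.diagonal fun i : Fin (p + 1) => (-1 : ℝ) ^ (i : ℕ) with hJ
  have hJJ : J⁻¹ = J := by
    refine Matrix.inv_eq_left_inv ?_
    rw [hJ, Matrix.diagonal_mul_diagonal, ← Matrix.diagonal_one]
    congr 1
    ext i
    rw [← pow_add, Even.neg_one_pow ⟨_, rfl⟩]
  have hS : J * Smat K p * J = Smat K p := by
    ext i j
    simp only [hJ, Matrix.mul_diagonal, Matrix.diagonal_mul, Smat, Matrix.of_apply]
    rcases Nat.even_or_odd ((i : ℕ) + (j : ℕ)) with h | h
    · rw [mul_right_comm, ← pow_add, h.neg_one_pow, one_mul]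
    · rw [kmom_odd_eq_zero hKsym h]; simp
  have h : (Smat K p)⁻¹ = J * ((Smat K p)⁻¹ * J) := by
    conv_lhs => rw [← hS, Matrix.mul_inv_rev, Matrix.mul_inv_rev, hJJ]
  have h2 := congrFun (congrFun h k) l
  simp only [hJ, Matrix.mul_diagonal, Matrix.diagonal_mul] at h2
  rw [← mul_assoc, mul_right_comm, ← pow_add, hkl.neg_one_pow] at h2
  linarith

theorem Smat_inv_transpose : ((Smat K p)⁻¹)ᵀ = (Smat K p)⁻¹ := by
  rw [Matrix.transpose_nonsing_inv]
  congr 1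
  ext k l
  simp [Smat, add_comm]

/-- The quadratic form of a rank-one matrix in the inverse moment matrix. -/
theorem Smat_inv_mul_mul_apply (a b : ℕ → ℝ) (ν : Fin (p + 1)) :
    ((Smat K p)⁻¹ * (Matrix.of fun k l : Fin (p + 1) => a k * b l) * (Smat K p)⁻¹) ν ν =
      (∑ k, (Smat K p)⁻¹ ν k * a k) * ∑ k, (Smat K p)⁻¹ ν k * b k := by
  have hsym : ∀ l, (Smat K p)⁻¹ l ν = (Smat K p)⁻¹ ν l := fun l =>
    congrFun (congrFun (Smat_inv_transpose (K := K) (p := p)) ν) l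
  rw [Finset.sum_mul_sum]
  simp only [Matrix.mul_apply, Matrix.of_apply, hsym, Finset.sum_mul]
  rw [Finset.sum_comm]
  exact Finset.sum_congr rfl fun k _ => Finset.sum_congr rfl fun l _ => by ring

theorem Smat_inv_mul_Sastmat_apply (ν : Fin (p + 1)) :
    ((Smat K p)⁻¹ * Sastmat K p * (Smat K p)⁻¹) ν ν =
      (∑ k, (Smat K p)⁻¹ ν k * kmom K (k + 0)) ^ 2 := by
  rw [sq, ← Smat_inv_mul_mul_apply (fun k => kmom K (k + 0)) (fun k => kmom K (k + 0))]
  rfl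

theorem Smat_inv_mul_A1mat_apply (ν : Fin (p + 1)) :
    ((Smat K p)⁻¹ * A1mat K p * (Smat K p)⁻¹) ν ν =
      (∑ k, (Smat K p)⁻¹ ν k * kmom K (k + 0)) * ∑ k, (Smat K p)⁻¹ ν k * kmom K (k + 2) := by
  have hA : A1mat K p = (1 / 2 : ℝ) •
      ((Matrix.of fun k l : Fin (p + 1) => kmom K (k + 0) * kmom K (l + 2)) +
        Matrix.of fun k l : Fin (p + 1) => kmom K (k + 2) * kmom K (l + 0)) := by
    ext k l
    simp [A1mat]
    ring
  rw [hA, Matrix.mul_smul, Matrix.smul_mul, Matrix.mul_add, Matrix.add_mul, Matrix.smul_apply,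
    Matrix.add_apply,
    Smat_inv_mul_mul_apply (fun k => kmom K (k + 0)) (fun k => kmom K (k + 2)),
    Smat_inv_mul_mul_apply (fun k => kmom K (k + 2)) (fun k => kmom K (k + 0)), smul_eq_mul]
  ring

/-- Entrywise convergence of the inverses of convergent matrices with invertible limit. -/
theorem tendsto_matrix_inv_apply {m ι : Type*} [Fintype m] [DecidableEq m] {l : Filter ι}
    {A : ι → Matrix m m ℝ} {B : Matrix m m ℝ} (hB : IsUnit B.det)
    (hA : Tendsto A l (𝓝 B)) (i j : m) : Tendsto (fun n => (A n)⁻¹ i j) l (𝓝 (B⁻¹ i j)) := by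
  have hdet : Tendsto (fun n => (A n).det) l (𝓝 B.det) :=
    ((continuous_id.matrix_det).tendsto B).comp hA
  have hadj : Tendsto (fun n => (A n).adjugate i j) l (𝓝 (B.adjugate i j)) :=
    (((continuous_id.matrix_adjugate).matrix_elem i j).tendsto B).comp hA
  simpa [Matrix.inv_def] using (hdet.inv₀ hB.ne_zero).mul hadj

theorem tendsto_empSmat
    (hmom : ∀ a, Tendsto (fun N => empMom K x (hN N) N a) atTop (𝓝 (kmom K a))) :
    Tendsto (fun N => empSmat K x (hN N) p N) atTop (𝓝 (Smat K p)) :=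
  tendsto_pi_nhds.2 fun k => tendsto_pi_nhds.2 fun l => hmom ((k : ℕ) + (l : ℕ))

/-- The first moment of the local polynomial weights of an even-order coefficient is of smaller
order than the bandwidth. -/
theorem tendsto_first_moment_div (hKsym : ∀ u, K (-u) = K u) (hS : IsUnit (Smat K p).det)
    {ν : Fin (p + 1)} (hν : Even (ν : ℕ))
    (hmom : ∀ a, Tendsto (fun N => empMom K x (hN N) N a) atTop (𝓝 (kmom K a)))
    (hrate : ∀ a, Tendsto (fun N => (empMom K x (hN N) N a - kmom K a) / hN N) atTop (𝓝 0)) :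
    Tendsto (fun N => (∑ k, (empSmat K x (hN N) p N)⁻¹ ν k * empMom K x (hN N) N (k + 1)) / hN N)
      atTop (𝓝 0) := by
  have hShat := tendsto_empSmat (p := p) hmom
  have hdet : ∀ᶠ N in atTop, (empSmat K x (hN N) p N).det ≠ 0 :=
    (((continuous_id.matrix_det).tendsto (Smat K p)).comp hShat).eventually_ne hS.ne_zero
  set μ : Fin (p + 1) → ℝ := fun k => kmom K (k + 1) with hμ
  set y : Fin (p + 1) → ℝ := (Smat K p)⁻¹ *ᵥ μ with hy
  have hyν : y ν = 0 := by
    simp only [hy, Matrix.mulVec, dotProduct]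
    refine Finset.sum_eq_zero fun k _ => ?_
    rcases Nat.even_or_odd (k : ℕ) with h | h
    · simp only [hμ]
      rw [kmom_odd_eq_zero hKsym h.add_one, mul_zero]
    · rw [Smat_inv_apply_eq_zero hKsym (hν.add_odd h), zero_mul]
  have hSy : ∀ k : Fin (p + 1), kmom K (k + 1) = ∑ l, Smat K p k l * y l := by
    intro k
    have h : Smat K p *ᵥ y = μ := by
      rw [hy, Matrix.mulVec_mulVec, Matrix.mul_nonsing_inv _ hS, Matrix.one_mulVec]
    exact (congrFun h k).symm
  have hE : ∀ k : Fin (p + 1), Tendsto (fun N => (empMom K x (hN N) N (k + 1) -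
      ∑ l, empSmat K x (hN N) p N k l * y l) / hN N) atTop (𝓝 0) := by
    intro k
    have h : Tendsto (fun N => (empMom K x (hN N) N (k + 1) - kmom K (k + 1)) / hN N -
        ∑ l : Fin (p + 1), (empMom K x (hN N) N (k + l) - kmom K (k + l)) / hN N * y l)
        atTop (𝓝 (0 - ∑ l : Fin (p + 1), 0 * y l)) :=
      (hrate _).sub (tendsto_finsetSum _ fun l _ => (hrate _).mul_const _)
    simp only [zero_mul, Finset.sum_const_zero, sub_zero] at h
    refine h.congr fun N => ?_
    rw [hSy k]
    simp only [empSmat, Smat, Matrix.of_apply, sub_div, Finset.sum_div, sub_mul,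
      Finset.sum_sub_distrib, mul_div_right_comm]
    ring
  have hlim : Tendsto (fun N => ∑ k, (empSmat K x (hN N) p N)⁻¹ ν k *
      ((empMom K x (hN N) N (k + 1) - ∑ l, empSmat K x (hN N) p N k l * y l) / hN N))
      atTop (𝓝 (∑ k, (Smat K p)⁻¹ ν k * 0)) :=
    tendsto_finsetSum _ fun k _ => (tendsto_matrix_inv_apply hS hShat ν k).mul (hE k)
  simp only [mul_zero, Finset.sum_const_zero] at hlim
  refine hlim.congr' ?_
  filter_upwards [hdet] with N hd
  have hPS : ∑ k, (empSmat K x (hN N) p N)⁻¹ ν k * ∑ l, empSmat K x (hN N) p N k l * y l = 0 := by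
    have h : (empSmat K x (hN N) p N)⁻¹ *ᵥ (empSmat K x (hN N) p N *ᵥ y) = y := by
      rw [Matrix.mulVec_mulVec, Matrix.nonsing_inv_mul _ (isUnit_iff_ne_zero.2 hd),
        Matrix.one_mulVec]
    exact (congrFun h ν).trans hyν
  rw [← sub_zero (∑ k, (empSmat K x (hN N) p N)⁻¹ ν k * empMom K x (hN N) N (k + 1)), ← hPS,
    ← Finset.sum_sub_distrib, Finset.sum_div]
  exact Finset.sum_congr rfl fun k _ => by ring

end Limits

/-- Quadratic expansion on the diagonal of a function symmetric near a diagonal point. -/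
theorem exists_quadratic_expansion_of_symm {ρ : ℝ → ℝ → ℝ} {x : ℝ}
    (hsym : ∀ᶠ z in 𝓝 x, ρ z x = ρ x z)
    (hρ : ContDiffAt ℝ 2 (fun q : ℝ × ℝ => ρ q.1 q.2) (x, x)) :
    ∃ α β b : ℝ, ∀ ε > 0, ∃ r > 0, ∀ s t d : ℝ, |s| ≤ d → |t| ≤ d → d < r →
      |ρ (x + s) (x + t) - (ρ x x + (α * s + β * t) +
        (iteratedDeriv 2 (fun z => ρ x z) x / 2 * s ^ 2 + b * (s * t) +
          iteratedDeriv 2 (fun z => ρ x z) x / 2 * t ^ 2))| ≤ ε * d ^ 2 := by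
  set f : ℝ × ℝ → ℝ := fun q => ρ q.1 q.2 with hf
  have h2 : iteratedDeriv 2 (fun z => ρ x z) x
      = fderiv ℝ (fderiv ℝ f) (x, x) (0, 1) (0, 1) :=
    ContDiffAt.iteratedDeriv_two_comp_line (c := fun z => (x, z)) (f := f)
      (fun t => (hasDerivAt_const t x).prodMk (hasDerivAt_id t)) hρ
  have h1 : iteratedDeriv 2 (fun z => ρ x z) x
      = fderiv ℝ (fderiv ℝ f) (x, x) (1, 0) (1, 0) := by
    rw [← Filter.EventuallyEq.iteratedDeriv_eq 2 hsym]
    exact ContDiffAt.iteratedDeriv_two_comp_line (c := fun z => (z, x)) (f := f)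
      (fun t => (hasDerivAt_id t).prodMk (hasDerivAt_const t x)) hρ
  have hv : ∀ s t : ℝ, ((s, t) : ℝ × ℝ) = s • ((1, 0) : ℝ × ℝ) + t • ((0, 1) : ℝ × ℝ) := by
    intro s t
    simp
  refine ⟨fderiv ℝ f (x, x) (1, 0), fderiv ℝ f (x, x) (0, 1),
    (fderiv ℝ (fderiv ℝ f) (x, x) (1, 0) (0, 1) +
      fderiv ℝ (fderiv ℝ f) (x, x) (0, 1) (1, 0)) / 2, fun ε hε => ?_⟩
  obtain ⟨r, hr, hball⟩ :=
    Metric.eventually_nhds_iff_ball.1 (hρ.eventually_taylor_two_remainder_le hε)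
  refine ⟨r, hr, fun s t d hs ht hd => ?_⟩
  have hnorm : ‖((s, t) : ℝ × ℝ)‖ ≤ d := by
    rw [Prod.norm_def]
    exact max_le hs ht
  have h := hball (s, t) (by rw [mem_ball_zero_iff]; exact hnorm.trans_lt hd)
  have hd2 : ε * ‖((s, t) : ℝ × ℝ)‖ ^ 2 ≤ ε * d ^ 2 := by gcongr
  refine le_trans (le_of_eq ?_) (h.trans hd2)
  congr 1
  have e1 : fderiv ℝ f (x, x) (s, t)
      = s * fderiv ℝ f (x, x) (1, 0) + t * fderiv ℝ f (x, x) (0, 1) := by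
    rw [hv s t, map_add, map_smul, map_smul, smul_eq_mul, smul_eq_mul]
  have e2 : fderiv ℝ (fderiv ℝ f) (x, x) (s, t) (s, t)
      = s ^ 2 * fderiv ℝ (fderiv ℝ f) (x, x) (1, 0) (1, 0)
        + s * t * (fderiv ℝ (fderiv ℝ f) (x, x) (1, 0) (0, 1) +
          fderiv ℝ (fderiv ℝ f) (x, x) (0, 1) (1, 0))
        + t ^ 2 * fderiv ℝ (fderiv ℝ f) (x, x) (0, 1) (0, 1) := by
    rw [hv s t]
    simp only [map_add, map_smul, _root_.add_apply, _root_.smul_apply,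
      smul_eq_mul]
    ring
  rw [e1, e2, ← h1, ← h2, Prod.mk_add_mk]
  ring

/-- Theorem 2 of the paper, case `ν` even: higher-order variance
expansion for the equidistant design with a covariance twice continuously
differentiable near `(x,x)`. -/
theorem stmt_13 (K : ℝ → ℝ) (L : NNReal) (hKlip : LipschitzWith L K)
    (hKnn : ∀ u, 0 ≤ K u) (hKsym : ∀ u, K (-u) = K u)
    (hKint : (∫ u, K u) = 1)
    (hKsupp : ∀ u, u ∉ Icc (-1:ℝ) 1 → K u = 0)
    (ρ : ℝ → ℝ → ℝ)
    (hρc : ContinuousOn (fun q : ℝ × ℝ => ρ q.1 q.2) (Icc 0 1 ×ˢ Icc 0 1))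
    (hρsym : ∀ s t, s ∈ Icc (0:ℝ) 1 → t ∈ Icc (0:ℝ) 1 → ρ s t = ρ t s)
    (p : ℕ) (ν : Fin (p + 1)) (hν : Even (ν : ℕ))
    (x : ℝ) (hx : x ∈ Ioo (0:ℝ) 1)
    (hρsm : ContDiffAt ℝ 2 (fun q : ℝ × ℝ => ρ q.1 q.2) (x, x))
    (hS : IsUnit (Smat K p).det)
    (hN : ℕ → ℝ) (hNpos : ∀ N, 0 < hN N)
    (hN0 : Tendsto hN atTop (𝓝 0))
    (hNh3 : Tendsto (fun N : ℕ => (N : ℝ) * hN N ^ 3) atTop atTop) :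
    (∀ᶠ N in atTop,
      IsUnit ((Xmat xdEq x p N)ᵀ * Wmat K xdEq x (hN N) N * Xmat xdEq x p N).det) ∧
    Tendsto (fun N : ℕ =>
        (hN N ^ (2 * (ν : ℕ)) * VN K xdEq ρ x (hN N) p N ν
          - ρ x x * ((Smat K p)⁻¹ * Sastmat K p * (Smat K p)⁻¹) ν ν
          - hN N ^ 2 * iteratedDeriv 2 (fun z => ρ x z) x *
              ((Smat K p)⁻¹ * A1mat K p * (Smat K p)⁻¹) ν ν)
          / hN N ^ 2)
      atTop (𝓝 0) := by
  have hrate2 := tendsto_empMom_sub_kmom_div_sq hKlip hKsupp hx hNpos hN0 hNh3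
  have hrate : ∀ a, Tendsto (fun N => (empMom K x (hN N) N a - kmom K a) / hN N)
      atTop (𝓝 0) := by
    intro a
    have h := (hrate2 a).mul hN0
    rw [zero_mul] at h
    refine h.congr fun N => ?_
    have := (hNpos N).ne'
    field_simp
  have hmom : ∀ a, Tendsto (fun N => empMom K x (hN N) N a) atTop (𝓝 (kmom K a)) := by
    intro a
    have h := ((hrate a).mul hN0).add_const (kmom K a)
    rw [zero_mul, zero_add] at h
    refine h.congr fun N => ?_
    rw [div_mul_cancel₀ _ (hNpos N).ne', sub_add_cancel]
  have hShat := tendsto_empSmat (p := p) hmom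
  have hdet : ∀ᶠ N in atTop, IsUnit (empSmat K x (hN N) p N).det :=
    ((((continuous_id.matrix_det).tendsto (Smat K p)).comp hShat).eventually_ne
      hS.ne_zero).mono fun N h => isUnit_iff_ne_zero.2 h
  refine ⟨?_, ?_⟩
  · filter_upwards [hdet, eventually_ge_atTop 2] with N hd hN2
    have hN1 : (N : ℝ) - 1 ≠ 0 := by
      have : (2:ℝ) ≤ N := by exact_mod_cast hN2
      linarith
    have hD : (Matrix.diagonal fun k : Fin (p + 1) => hN N ^ (k : ℕ)).det ≠ 0 := by
      rw [Matrix.det_diagonal]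
      exact Finset.prod_ne_zero_iff.2 fun k _ => pow_ne_zero _ (hNpos N).ne'
    rw [transpose_mul_Wmat_mul_Xmat (hNpos N) hN2, Matrix.det_smul, Matrix.det_mul,
      Matrix.det_mul, isUnit_iff_ne_zero]
    exact mul_ne_zero (pow_ne_zero _ hN1) (mul_ne_zero (mul_ne_zero hD hd.ne_zero) hD)
  have hP := tendsto_matrix_inv_apply hS hShat ν
  set z : ℕ → ℝ := fun r => ∑ k, (Smat K p)⁻¹ ν k * kmom K (k + r) with hz
  set ζ : ℕ → ℕ → ℝ := fun r N =>
    ∑ k, (empSmat K x (hN N) p N)⁻¹ ν k * empMom K x (hN N) N (k + r) with hζ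
  have hζz : ∀ r, Tendsto (ζ r) atTop (𝓝 (z r)) := fun r =>
    tendsto_finsetSum _ fun k _ => (hP k).mul (hmom _)
  have hζ1 : Tendsto (fun N => ζ 1 N / hN N) atTop (𝓝 0) :=
    tendsto_first_moment_div hKsym hS hν hmom hrate
  have hζ1' : Tendsto (ζ 1) atTop (𝓝 0) := by
    have h := hζ1.mul hN0
    rw [zero_mul] at h
    exact h.congr fun N => div_mul_cancel₀ _ (hNpos N).ne'
  have hz0 : z 0 = (1 : Matrix (Fin (p + 1)) (Fin (p + 1)) ℝ) ν 0 := by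
    rw [← Matrix.nonsing_inv_mul _ hS, Matrix.mul_apply]
    rfl
  have hζ0 : ∀ᶠ N in atTop, ζ 0 N = z 0 := by
    filter_upwards [hdet] with N hd
    rw [hz0, ← Matrix.nonsing_inv_mul _ hd, Matrix.mul_apply]
    rfl
  have hsymx : ∀ᶠ t in 𝓝 x, ρ t x = ρ x t := by
    filter_upwards [Icc_mem_nhds hx.1 hx.2] with t ht
    exact hρsym t x ht ⟨hx.1.le, hx.2.le⟩
  obtain ⟨α, β, b, hexp⟩ := exists_quadratic_expansion_of_symm hsymx hρsm
  rw [Smat_inv_mul_Sastmat_apply, Smat_inv_mul_A1mat_apply]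
  set c := iteratedDeriv 2 (fun t => ρ x t) x with hc
  set Q : ℕ → ℝ := fun N => ρ x x * ζ 0 N ^ 2
    + (hN N * α + hN N * β) * (ζ 0 N * ζ 1 N)
    + ((hN N ^ 2 * (c / 2) + hN N ^ 2 * (c / 2)) * (ζ 0 N * ζ 2 N)
      + hN N ^ 2 * b * ζ 1 N ^ 2) with hQ
  have hrem : Tendsto (fun N => (hN N ^ (2 * (ν : ℕ)) * VN K xdEq ρ x (hN N) p N ν - Q N)
      / hN N ^ 2) atTop (𝓝 0) := by
    set A : ℕ → ℝ := fun N => ∑ k, |(empSmat K x (hN N) p N)⁻¹ ν k| with hA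
    set B : ℝ := ((∑ k, |(Smat K p)⁻¹ ν k|) * kmom K 0) ^ 2 with hB
    have hAB : Tendsto (fun N => (A N * empMom K x (hN N) N 0) ^ 2) atTop (𝓝 B) :=
      ((tendsto_finsetSum _ fun k _ => (hP k).abs).mul (hmom 0)).pow 2
    have hB0 : 0 ≤ B := sq_nonneg _
    rw [Metric.tendsto_nhds]
    intro η hη
    obtain ⟨r, hr, hexp⟩ := hexp (η / (2 * (B + 1))) (by positivity)
    filter_upwards [hAB.eventually_lt_const (lt_add_one B), hN0.eventually_lt_const hr,
      eventually_ge_atTop 2] with N hAN hNr hN2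
    have hh := hNpos N
    have hmain := abs_sum_sum_mul_sub_quadratic_le
      (w := fun i : Fin N => empWeight K x (hN N) p N ν i)
      (κ := fun i : Fin N => (((N : ℝ) - 1) * hN N)⁻¹ * K (scaledNode x (hN N) N i))
      (u := fun i : Fin N => scaledNode x (hN N) N i)
      (r := fun i j : Fin N => ρ (x + hN N * scaledNode x (hN N) N i)
        (x + hN N * scaledNode x (hN N) N j))
      (c₀ := ρ x x) (α := hN N * α) (β := hN N * β) (a := hN N ^ 2 * (c / 2))
      (b := hN N ^ 2 * b) (c := hN N ^ 2 * (c / 2))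
      (η := η / (2 * (B + 1)) * hN N ^ 2) (A := A N)
      (fun i => abs_empWeight_le hKnn hKsupp hh hN2 ν i) ?_
    · simp only [sum_empWeight_mul_pow] at hmain
      rw [← pow_mul_VN_eq hh hN2 ν, ← Finset.mul_sum,
        show ∑ i : Fin N, K (scaledNode x (hN N) N i)
          = ∑ i : Fin N, scaledNode x (hN N) N i ^ 0 * K (scaledNode x (hN N) N i) by simp]
        at hmain
      change |hN N ^ (2 * (ν : ℕ)) * VN K xdEq ρ x (hN N) p N ν - Q N| ≤
        η / (2 * (B + 1)) * hN N ^ 2 * (A N * empMom K x (hN N) N 0) ^ 2 at hmain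
      rw [dist_zero_right, Real.norm_eq_abs, abs_div, abs_of_pos (pow_pos hh 2),
        div_lt_iff₀ (pow_pos hh 2)]
      calc _ ≤ η / (2 * (B + 1)) * hN N ^ 2 * (A N * empMom K x (hN N) N 0) ^ 2 := hmain
        _ ≤ η / (2 * (B + 1)) * hN N ^ 2 * (B + 1) := by gcongr
        _ = η / 2 * hN N ^ 2 := by field_simp
        _ < η * hN N ^ 2 := by gcongr; linarith
    · intro i j hi hj
      have hnode : ∀ i : Fin N, (((N : ℝ) - 1) * hN N)⁻¹ * K (scaledNode x (hN N) N i) ≠ 0 →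
          |hN N * scaledNode x (hN N) N i| ≤ hN N := by
        intro i hi
        have hm : scaledNode x (hN N) N i ∈ Icc (-1:ℝ) 1 := by
          by_contra hm
          exact hi (by rw [hKsupp _ hm, mul_zero])
        rw [abs_mul, abs_of_pos hh]
        exact mul_le_of_le_one_right hh.le (abs_le.2 hm)
      refine le_trans (le_of_eq ?_) (hexp _ _ _ (hnode i hi) (hnode j hj) hNr)
      congr 1
      ring
  have hlim := (((hζ1.const_mul ((α + β) * z 0)).add
    (((hζz 2).sub_const (z 2)).const_mul (c * z 0))).add ((hζ1'.pow 2).const_mul b)).add hrem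
  simp only [sub_self, mul_zero, add_zero, ne_eq, OfNat.ofNat_ne_zero, not_false_eq_true,
    zero_pow] at hlim
  refine hlim.congr' ?_
  filter_upwards [hζ0] with N h0
  have hh := (hNpos N).ne'
  simp only [hQ, h0]
  change _ = (_ - ρ x x * z 0 ^ 2 - hN N ^ 2 * c * (z 0 * z 2)) / hN N ^ 2
  field_simp
  ring
end
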